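/- Let k be a number field. For every ε > 0 there is a constant depending only on k and ε such that for every squarefree integral ideal q of O_k, the number of S3-cubic extensions K/k (up to isomorphism) with Disc(K) ≤ X that are partially ramified at every prime dividing q is at most O_{k,ε}(X / |q|^{1/6 − ε}); the implied constant is independent of q. -/

import Mathlib

open scoped Classical NumberField

noncomputable section

variable (k : Type*) [Field k] [NumberField k]

local notation "kbar" => AlgebraicClosure k

/-- The permutation of the embeddings of `K` into `kbar` induced by an automorphism
of `kbar` over `k` (acting by post-composition). -/
def galPerm (K : IntermediateField k kbar) (σ : kbar ≃ₐ[k] kbar) :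
    Equiv.Perm (K →ₐ[k] kbar) where
  toFun f := σ.toAlgHom.comp f
  invFun f := σ.symm.toAlgHom.comp f
  left_inv f := by ext x; simp
  right_inv f := by ext x; simp

/-- The action of the absolute Galois group of `k` on the embeddings of `K`, as a
homomorphism to the permutation group of the embeddings.  Its image is isomorphic to the
Galois group of the Galois closure of `K` over `k`, viewed as a permutation group on the
embeddings of `K`. -/
def galPermHom (K : IntermediateField k kbar) :
    (kbar ≃ₐ[k] kbar) →* Equiv.Perm (K →ₐ[k] kbar) where
  toFun := galPerm k K
  map_one' := by
    refine Equiv.ext fun f => AlgHom.ext fun x => ?_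
    simp [galPerm]
  map_mul' σ τ := by
    refine Equiv.ext fun f => AlgHom.ext fun x => ?_
    simp [galPerm]

/-- `K` is an `S3`-cubic extension of `k`: it has degree `3` over `k` and the Galois group
of its Galois closure over `k` is the full symmetric group on the three embeddings of `K`
into `kbar`, i.e. the absolute Galois group of `k` surjects onto this symmetric group. -/
def IsSThreeCubic (K : IntermediateField k kbar) : Prop :=
  Module.finrank k K = 3 ∧ Function.Surjective (galPermHom k K)

/-- `Disc(K)`: the absolute norm to `ℚ` of the discriminant of `K/ℚ`
(junk value `0` if `K` is infinite-dimensional over `k`). -/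
def absDisc (K : IntermediateField k kbar) : ℕ :=
  haveI : CharZero K := (algebraMap K kbar).charZero
  if h : FiniteDimensional k K then
    haveI := h
    haveI : IsScalarTower ℚ k K := IsScalarTower.of_algebraMap_eq' (Subsingleton.elim _ _)
    haveI : FiniteDimensional ℚ K := Module.Finite.trans k K
    haveI : NumberField K := ⟨⟩
    (NumberField.discr K).natAbs
  else 0

/-- `K` is partially ramified at the prime `p` of `k`: `p 𝒪_K = P₁² P₂`
with `P₁ ≠ P₂` prime. -/
def PartiallyRamified (K : IntermediateField k kbar) (p : Ideal (𝓞 k)) : Prop :=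
  ∃ P₁ P₂ : Ideal (𝓞 K), P₁.IsPrime ∧ P₂.IsPrime ∧ P₁ ≠ P₂ ∧
    Ideal.map (algebraMap (𝓞 k) (𝓞 K)) p = P₁ ^ 2 * P₂

/-- `K` is totally ramified at the prime `p` of `k`: `p 𝒪_K = P³` with `P` prime. -/
def TotallyRamified (K : IntermediateField k kbar) (p : Ideal (𝓞 k)) : Prop :=
  ∃ P : Ideal (𝓞 K), P.IsPrime ∧
    Ideal.map (algebraMap (𝓞 k) (𝓞 K)) p = P ^ 3

/-- Two subfields of `kbar` are identified when they are isomorphic over `k`. -/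
def isoSetoid : Setoid (IntermediateField k kbar) where
  r K L := Nonempty (K ≃ₐ[k] L)
  iseqv := ⟨fun _ => ⟨AlgEquiv.refl⟩, fun ⟨e⟩ => ⟨e.symm⟩, fun ⟨e⟩ ⟨f⟩ => ⟨e.trans f⟩⟩

/-- The number of isomorphism classes of members of a given collection of extensions
of `k` inside `kbar`. -/
def countClasses (S : Set (IntermediateField k kbar)) : ℕ :=
  Nat.card (Quotient (Setoid.comap (Subtype.val : S → _) (isoSetoid k)))

namespace CubicCount

open NumberField Module

section House
variable {F : Type*} [Field F] [NumberField F]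

lemma one_le_house {x : 𝓞 F} (hx : x ≠ 0) : 1 ≤ house (x : F) :=
  one_le_house_of_isIntegral x.isIntegral_coe (by simpa using hx)

lemma house_neg (x : F) : house (-x) = house x := by
  simp [house]

lemma house_sub_le (x y : F) : house (x - y) ≤ house x + house y := by
  rw [sub_eq_add_neg, ← house_neg y]; exact house_add_le _ _

lemma house_le_iff {x : F} {B : ℝ} (hB : 0 ≤ B) : house x ≤ B ↔ ∀ φ : F →+* ℂ, ‖φ x‖ ≤ B := by
  rw [house, pi_norm_le_iff_of_nonneg hB]; rfl

lemma abs_norm_le_house_pow (x : F) :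
    |(Algebra.norm ℚ x : ℝ)| ≤ house x ^ finrank ℚ F := by
  obtain ⟨σ⟩ : Nonempty (F →+* ℂ) := inferInstance
  have h := norm_norm_le_norm_mul_house_pow x σ
  have h2 := mul_le_mul_of_nonneg_right (norm_embedding_le_house x σ)
    (pow_nonneg (house_nonneg x) (finrank ℚ F - 1))
  rw [← pow_succ', Nat.sub_add_cancel finrank_pos] at h2
  have h3 := h.trans h2
  rwa [← Rat.norm_cast_real, Real.norm_eq_abs] at h3

lemma absNorm_le_house_pow {I : Ideal (𝓞 F)} {x : 𝓞 F} (hx : x ∈ I) (hx0 : x ≠ 0) :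
    (Ideal.absNorm I : ℝ) ≤ house (x : F) ^ finrank ℚ F := by
  refine le_trans ?_ (abs_norm_le_house_pow (x : F))
  have h1 : Ideal.absNorm I ≤ (Algebra.norm ℤ x).natAbs := by
    refine Nat.le_of_dvd ?_ ?_
    · simpa [Int.natAbs_pos, Algebra.norm_eq_zero_iff] using hx0
    · have := Ideal.absNorm_dvd_absNorm_of_le ((Ideal.span_singleton_le_iff_mem I).mpr hx)
      rwa [Ideal.absNorm_span_singleton] at this
  have h2 : (Algebra.norm ℚ (x : F)) = ((Algebra.norm ℤ x : ℤ) : ℚ) := by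
    rw [← Algebra.coe_norm_int]
  rw [h2]
  have h3 : ((Ideal.absNorm I : ℤ) : ℝ) ≤ ((|Algebra.norm ℤ x| : ℤ) : ℝ) := by
    rw [Int.abs_eq_natAbs]; exact_mod_cast h1
  simpa using h3

variable (F) in
lemma exists_coord_bound : ∃ c : ℝ, 1 ≤ c ∧
    (∀ x : 𝓞 F, ∀ i, |((RingOfIntegers.basis F).repr x i : ℝ)| ≤ c * house (x : F)) ∧
    (∀ x : 𝓞 F, ∀ B : ℝ, (∀ i, |((RingOfIntegers.basis F).repr x i : ℝ)| ≤ B) →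
      house (x : F) ≤ c * B) := by
  set b := RingOfIntegers.basis F
  set L := canonicalEmbedding.latticeBasis F
  let T : ((F →+* ℂ) → ℂ) →L[ℂ] (_ → ℂ) := LinearMap.toContinuousLinearMap L.equivFun.toLinearMap
  have hT : ∀ x : 𝓞 F, ∀ i, T (canonicalEmbedding F x) i = (b.repr x i : ℂ) := by
    intro x i
    have h1 : canonicalEmbedding F x = ∑ j, (b.repr x j : ℂ) • L j := by
      conv_lhs => rw [← b.sum_repr x]
      simp [L, b, canonicalEmbedding.latticeBasis_apply, Algebra.smul_def, integralBasis_apply]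
    simp only [T, LinearMap.coe_toContinuousLinearMap', LinearEquiv.coe_coe]
    rw [h1, Basis.equivFun_apply]
    simp [Finsupp.single_apply]
  refine ⟨1 + ‖T‖ + ∑ i, house ((b i : 𝓞 F) : F), ?_, ?_, ?_⟩
  · have : 0 ≤ ∑ i, house ((b i : 𝓞 F) : F) := Finset.sum_nonneg fun _ _ => house_nonneg _
    have := norm_nonneg T
    linarith
  · intro x i
    have h0 : 0 ≤ ∑ i, house ((b i : 𝓞 F) : F) := Finset.sum_nonneg fun _ _ => house_nonneg _
    have h1 : |((b.repr x i : ℤ) : ℝ)| = ‖T (canonicalEmbedding F x) i‖ := by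
      rw [hT]; simp
    rw [h1]
    calc _ ≤ ‖T (canonicalEmbedding F x)‖ := norm_le_pi_norm _ i
      _ ≤ ‖T‖ * house (x : F) := T.le_opNorm _
      _ ≤ _ := by
        apply mul_le_mul_of_nonneg_right _ (house_nonneg _); linarith
  · intro x B hB
    have hx : (x : F) = ∑ i, ((b.repr x i : ℤ) : F) * ((b i : 𝓞 F) : F) := by
      conv_lhs => rw [← b.sum_repr x]
      simp [zsmul_eq_mul]
    rw [hx]
    obtain ⟨i0⟩ : Nonempty (Free.ChooseBasisIndex ℤ (𝓞 F)) := inferInstance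
    have hB0 : 0 ≤ B := (abs_nonneg _).trans (hB i0)
    calc _ ≤ ∑ i, house (((b.repr x i : ℤ) : F) * ((b i : 𝓞 F) : F)) := house_sum_le_sum_house _ _
      _ ≤ ∑ i, B * house ((b i : 𝓞 F) : F) := by
        refine Finset.sum_le_sum fun i _ => (house_mul_le _ _).trans ?_
        rw [house_intCast]
        exact mul_le_mul_of_nonneg_right (by simpa using hB i) (house_nonneg _)
      _ = (∑ i, house ((b i : 𝓞 F) : F)) * B := by rw [← Finset.mul_sum, mul_comm]
      _ ≤ _ := by
        apply mul_le_mul_of_nonneg_right _ hB0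
        have := norm_nonneg T
        linarith

variable (F) in
lemma card_coord : Fintype.card (Free.ChooseBasisIndex ℤ (𝓞 F)) = finrank ℚ F := by
  rw [← RingOfIntegers.rank, finrank_eq_card_chooseBasisIndex]

variable (F) in
/-- Points of bounded house in a coset of an ideal. -/
lemma exists_card_le : ∃ C : ℝ, 1 ≤ C ∧ ∀ I : Ideal (𝓞 F), I ≠ ⊥ → ∀ B : ℝ, 0 ≤ B →
    ∀ S : Finset (𝓞 F), (∀ x ∈ S, house (x : F) ≤ B) → (∀ x ∈ S, ∀ y ∈ S, x - y ∈ I) →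
    (S.card : ℝ) ≤ C * (B ^ finrank ℚ F / Ideal.absNorm I + 1) := by
  obtain ⟨c, hc, hc1, hc2⟩ := exists_coord_bound F
  set n := finrank ℚ F with hn
  have hn0 : n ≠ 0 := finrank_pos.ne'
  refine ⟨(8 * c ^ 2) ^ n, one_le_pow₀ (by nlinarith), ?_⟩
  intro I hI B hB S hS hSI
  have hN : (0 : ℝ) < Ideal.absNorm I := by
    exact_mod_cast Nat.pos_of_ne_zero (by simpa [Ideal.absNorm_eq_zero_iff] using hI)
  set r : ℝ := (Ideal.absNorm I : ℝ) ^ ((n : ℝ)⁻¹) with hr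
  have hr0 : 0 < r := Real.rpow_pos_of_pos hN _
  have hrn : r ^ n = Ideal.absNorm I := Real.rpow_inv_natCast_pow hN.le hn0
  have hsep : ∀ x ∈ S, ∀ y ∈ S, x ≠ y → r ≤ house ((x - y : 𝓞 F) : F) := by
    intro x hx y hy hxy
    have h := absNorm_le_house_pow (hSI x hx y hy) (sub_ne_zero.mpr hxy)
    rw [← hrn] at h
    exact le_of_pow_le_pow_left₀ hn0 (house_nonneg _) h
  set δ := r / (2 * c) with hδ
  have hδ0 : 0 < δ := by positivity
  set b := RingOfIntegers.basis F
  let f : 𝓞 F → (Free.ChooseBasisIndex ℤ (𝓞 F) → ℤ) := fun x i => ⌊(b.repr x i : ℝ) / δ⌋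
  have hinj : Set.InjOn f S := by
    intro x hx y hy hxy
    by_contra hne
    have h1 := hsep x hx y hy hne
    have h2 : house ((x - y : 𝓞 F) : F) ≤ c * δ := by
      refine hc2 _ _ fun i => ?_
      have h3 := Int.abs_sub_lt_one_of_floor_eq_floor (congrFun hxy i)
      rw [← sub_div, abs_div, abs_of_pos hδ0, div_lt_one hδ0] at h3
      have h4 : ((b.repr (x - y) i : ℤ) : ℝ) = (b.repr x i : ℝ) - b.repr y i := by simp
      rw [h4]; exact h3.le
    have h5 : c * δ = r / 2 := by rw [hδ]; field_simp
    linarith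
  set M : ℤ := ⌈c * B / δ⌉ with hM
  have hM0 : 0 ≤ M := Int.ceil_nonneg (by positivity)
  have himg : S.image f ⊆ Fintype.piFinset fun _ => Finset.Icc (-M) M := by
    intro g hg
    obtain ⟨x, hx, rfl⟩ := Finset.mem_image.mp hg
    rw [Fintype.mem_piFinset]
    intro i
    have h1 : |(b.repr x i : ℝ)| ≤ c * B :=
      (hc1 x i).trans (mul_le_mul_of_nonneg_left (hS x hx) (by linarith))
    obtain ⟨h2, h3⟩ := abs_le.mp h1
    have h6 : c * B / δ ≤ M := Int.le_ceil _
    rw [Finset.mem_Icc]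
    constructor
    · apply Int.le_floor.mpr
      push_cast
      calc -(M : ℝ) ≤ -(c * B / δ) := by linarith
        _ = (-(c * B)) / δ := by ring
        _ ≤ _ := by gcongr
    · have : ((f x i : ℤ) : ℝ) ≤ M := (Int.floor_le _).trans (le_trans (by gcongr) h6)
      exact_mod_cast this
  have hcard : (S.card : ℝ) ≤ (2 * M + 1 : ℝ) ^ n := by
    have h1 := Finset.card_le_card himg
    rw [Finset.card_image_of_injOn hinj,
      Fintype.card_piFinset, Finset.prod_const, Finset.card_univ, Int.card_Icc, card_coord,
      ← hn] at h1
    have h2 : (((M + 1 - -M).toNat : ℕ) : ℝ) = 2 * M + 1 := by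
      have : (((M + 1 - -M).toNat : ℕ) : ℤ) = 2 * M + 1 := by
        rw [Int.toNat_of_nonneg (by omega)]; ring
      exact_mod_cast congrArg (Int.cast (R := ℝ)) this
    rw [← h2]
    exact_mod_cast h1
  have hMr : (M : ℝ) ≤ 2 * c ^ 2 * (B / r) + 1 := by
    have h1 : (M : ℝ) < c * B / δ + 1 := Int.ceil_lt_add_one _
    have h2 : c * B / δ = 2 * c ^ 2 * (B / r) := by rw [hδ]; field_simp
    linarith
  have hM0' : (0 : ℝ) ≤ M := by exact_mod_cast hM0
  have hBr : 0 ≤ B / r := by positivity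
  calc (S.card : ℝ) ≤ (2 * M + 1 : ℝ) ^ n := hcard
    _ ≤ (4 * c ^ 2 * (B / r + 1)) ^ n := by
      apply pow_le_pow_left₀ (by positivity)
      nlinarith
    _ = (4 * c ^ 2) ^ n * (B / r + 1) ^ n := mul_pow _ _ _
    _ ≤ (4 * c ^ 2) ^ n * (2 ^ n * ((B / r) ^ n + 1)) := by
      gcongr
      refine (add_pow_le hBr zero_le_one n).trans ?_
      rw [one_pow]
      gcongr
      · norm_num
      · omega
    _ = (8 * c ^ 2) ^ n * (B ^ n / Ideal.absNorm I + 1) := by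
      rw [← mul_assoc, ← mul_pow, div_pow, hrn]; ring_nf

variable (F) in
lemma exists_card_ge : ∃ c : ℝ, 0 < c ∧ ∀ B : ℝ, 0 ≤ B →
    ∃ S : Finset (𝓞 F), (∀ x ∈ S, house (x : F) ≤ B) ∧ c * B ^ finrank ℚ F ≤ S.card := by
  obtain ⟨c, hc, hc1, hc2⟩ := exists_coord_bound F
  have hc0 : 0 < c := by linarith
  set b := RingOfIntegers.basis F
  refine ⟨(1 / c) ^ finrank ℚ F, by positivity, fun B hB => ?_⟩
  let f : (Free.ChooseBasisIndex ℤ (𝓞 F) → ℕ) → 𝓞 F := fun g => ∑ i, (g i : ℤ) • b i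
  have hf : ∀ g i, b.repr (f g) i = g i := by
    intro g i
    have := congrFun (b.equivFun.apply_symm_apply (fun i => (g i : ℤ))) i
    rwa [Basis.equivFun_symm_apply, Basis.equivFun_apply] at this
  have hinj : Function.Injective f := by
    intro g g' h
    ext i
    have := hf g i
    rw [h, hf] at this
    exact_mod_cast this.symm
  refine ⟨(Fintype.piFinset fun _ => Finset.range (⌊B / c⌋₊ + 1)).image f, ?_, ?_⟩
  · intro x hx
    obtain ⟨g, hg, rfl⟩ := Finset.mem_image.mp hx
    have h1 : c * (B / c) = B := by field_simp
    rw [← h1]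
    refine hc2 _ _ fun i => ?_
    have h2 := Fintype.mem_piFinset.mp hg i
    rw [hf]
    rw [Finset.mem_range, Nat.lt_succ_iff, Nat.le_floor_iff (by positivity)] at h2
    simpa using h2
  · rw [Finset.card_image_of_injective _ hinj, Fintype.card_piFinset, Finset.prod_const,
      Finset.card_univ,
      Finset.card_range,
      card_coord, ← mul_pow, one_div_mul_eq_div]
    push_cast
    exact pow_le_pow_left₀ (by positivity) (Nat.lt_floor_add_one _).le _

end House

section Minkowski
open MeasureTheory

lemma prod_le_covolume {E : Type*} [NormedAddCommGroup E] [InnerProductSpace ℝ E]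
    [FiniteDimensional ℝ E] [MeasurableSpace E] [BorelSpace E] (L : Submodule ℤ E)
    [DiscreteTopology L] [IsZLattice ℝ L] {N : ℕ} (hNpos : 0 < N)
    (hN : finrank ℝ E = N) (f : Fin N → E) (r : Fin N → ℝ) (hr : ∀ i, 0 < r i) (hmono : Monotone r)
    (hL : ∀ v ∈ L, ∀ i, ‖v‖ < r i → v ∈ Submodule.span ℝ (f '' Set.Iio i)) :
    ∏ i, r i ≤ (N : ℝ) ^ N * ZLattice.covolume L := by
  set u := InnerProductSpace.gramSchmidtOrthonormalBasis
    (by simpa using hN : finrank ℝ E = Fintype.card (Fin N)) f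
    with hu
  by_contra! hlt
  have hNR : (0 : ℝ) < N := by exact_mod_cast hNpos
  set s : Set E := {v | ∀ i, |inner ℝ (u i) v| < r i / N} with hs
  have hvol : volume s = ENNReal.ofReal (∏ i, (2 * (r i / N))) := by
    have h1 := (PiLp.volume_preserving_ofLp (Fin N)).comp u.measurePreserving_repr
    have h2 : s = (fun v => WithLp.ofLp (u.repr v)) ⁻¹'
        (Set.univ.pi fun i => Set.Ioo (-(r i / N)) (r i / N)) := by
      ext v
      simp [hs, OrthonormalBasis.repr_apply_apply, abs_lt]
    rw [h2]
    have h3 := h1.measure_preimage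
      (s := Set.univ.pi fun i => Set.Ioo (-(r i / N)) (r i / N))
      (MeasurableSet.univ_pi fun i => measurableSet_Ioo).nullMeasurableSet
    refine h3.trans ?_
    rw [volume_pi_pi, ENNReal.ofReal_prod_of_nonneg]
    · simp [Real.volume_Ioo, two_mul]
    · intro i _
      have := hr i
      positivity
  have hfund := ZLattice.isAddFundamentalDomain (L := L) (Free.chooseBasis ℤ L) volume
  have hcov := ZLattice.covolume_eq_measure_fundamentalDomain L volume hfund
  set D := ZSpan.fundamentalDomain ((Free.chooseBasis ℤ L).ofZLatticeBasis ℝ L)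
  have hDfin : volume D ≠ ⊤ := by
    intro h
    have h2 := ZLattice.covolume_pos L volume
    rw [hcov, measureReal_def, h] at h2
    simp at h2
  have hmink : volume D * 2 ^ finrank ℝ E < volume s := by
    rw [hvol, hN, ← ENNReal.ofReal_toReal hDfin, ← measureReal_def, ← hcov]
    have h2 : (2 : ENNReal) ^ N = ENNReal.ofReal (2 ^ N) := by
      rw [ENNReal.ofReal_pow (by norm_num)]; simp
    rw [h2, ← ENNReal.ofReal_mul (ZLattice.covolume_pos L volume).le]
    rw [ENNReal.ofReal_lt_ofReal_iff]
    · rw [Finset.prod_mul_distrib, Finset.prod_div_distrib]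
      simp only [Finset.prod_const, Finset.card_univ, Fintype.card_fin]
      rw [mul_comm]
      gcongr
      rw [lt_div_iff₀ (by positivity), mul_comm]
      exact hlt
    · exact Finset.prod_pos fun i _ => by have := hr i; positivity
  have hsymm : ∀ x ∈ s, -x ∈ s := by
    intro x hx i
    simpa using hx i
  have hconv : Convex ℝ s := by
    have : s = ⋂ i, (innerSL ℝ (u i)) ⁻¹' (Metric.ball 0 (r i / N)) := by
      ext v; simp [hs]
    rw [this]
    exact convex_iInter fun i => (convex_ball _ _).linear_preimage (innerSL ℝ (u i)).toLinearMap
  have : Countable L.toAddSubgroup := inferInstanceAs (Countable L)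
  obtain ⟨x, hx0, hxs⟩ := exists_ne_zero_mem_lattice_of_measure_mul_two_pow_lt_measure
    (L := L.toAddSubgroup) hfund hsymm hconv hmink
  have hx0' : (x : E) ≠ 0 := by simpa using hx0
  have hne : (Finset.univ.filter fun i => inner ℝ (u i) (x : E) ≠ 0).Nonempty := by
    by_contra h
    rw [Finset.not_nonempty_iff_eq_empty, Finset.filter_eq_empty_iff] at h
    apply hx0'
    rw [← u.sum_repr' (x : E)]
    exact Finset.sum_eq_zero fun i _ => by
      have := h (Finset.mem_univ i)
      simp only [ne_eq, not_not] at this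
      rw [this, zero_smul]
  set i := (Finset.univ.filter fun i => inner ℝ (u i) (x : E) ≠ 0).max' hne with hi
  have hi1 : inner ℝ (u i) (x : E) ≠ 0 := by
    simpa using (Finset.max'_mem _ hne)
  have hi2 : ∀ l, i < l → inner ℝ (u l) (x : E) = 0 := by
    intro l hl
    by_contra h
    exact absurd (Finset.le_max' _ l (by simpa using h)) (not_le.mpr hl)
  have hnorm : ‖(x : E)‖ < r i := by
    conv_lhs => rw [← u.sum_repr' (x : E)]
    calc _ ≤ ∑ l, ‖inner ℝ (u l) (x : E) • u l‖ := norm_sum_le _ _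
      _ < ∑ l : Fin N, r i / N := by
        apply Finset.sum_lt_sum_of_nonempty ⟨i, Finset.mem_univ i⟩
        intro l _
        rw [norm_smul, u.norm_eq_one, mul_one, Real.norm_eq_abs]
        by_cases hl : i < l
        · rw [hi2 l hl]; have := hr i; simp; positivity
        · refine (hxs l).trans_le ?_
          gcongr
          exact hmono (not_lt.mp hl)
      _ = r i := by simp; field_simp
  have hspan := hL x x.2 i hnorm
  apply hi1
  have hle : Submodule.span ℝ (f '' Set.Iio i) ≤ LinearMap.ker (innerSL ℝ (u i)).toLinearMap := by
    rw [Submodule.span_le]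
    rintro _ ⟨l, hl, rfl⟩
    simpa using InnerProductSpace.gramSchmidtOrthonormalBasis_inv_triangular _ f hl
  simpa using hle hspan

lemma prod_le_sqrt_discr (K : Type*) [Field K] [NumberField K] {N : ℕ} (hN : finrank ℚ K = N)
    (b : Fin N → K) (r : Fin N → ℝ) (hr : ∀ i, 0 < r i) (hmono : Monotone r)
    (hL : ∀ γ : 𝓞 K, ∀ i, house (γ : K) < r i → (γ : K) ∈ Submodule.span ℚ (b '' Set.Iio i)) :
    ∏ i, r i ≤ (N : ℝ) ^ N * √|discr K| := by
  set T := mixedEmbedding.euclidean.toMixed K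
  have h := prod_le_covolume (mixedEmbedding.euclidean.integerLattice K)
    (hN ▸ finrank_pos) ((mixedEmbedding.euclidean.finrank K).trans hN)
    (fun i => T.symm (mixedEmbedding K (b i)))
    r hr hmono ?_
  · refine h.trans ?_
    gcongr
    rw [mixedEmbedding.euclidean.integerLattice]
    have := ZLattice.covolume_comap (mixedEmbedding.integerLattice K) volume volume
      (mixedEmbedding.euclidean.volumePreserving_toMixed K)
    refine (this.trans (mixedEmbedding.covolume_integerLattice K)).le.trans ?_
    refine mul_le_of_le_one_left (Real.sqrt_nonneg _) ?_
    exact pow_le_one₀ (by norm_num) (by norm_num)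
  · intro v hv i hi
    have hv' : T v ∈ mixedEmbedding.integerLattice K := hv
    obtain ⟨γ, hγ⟩ := hv'
    have hγ' : mixedEmbedding K (γ : K) = T v := hγ
    have hh : house (γ : K) ≤ ‖v‖ := by
      rw [house_le_iff (norm_nonneg _)]
      intro φ
      have hw : ‖φ (γ : K)‖ = InfinitePlace.mk φ (γ : K) := rfl
      rw [hw]
      set w := InfinitePlace.mk φ
      rcases w.isReal_or_isComplex with h | h
      · have h1 := (mixedEmbedding.normAtPlace_apply_of_isReal h (mixedEmbedding K (γ : K)))
        rw [mixedEmbedding.normAtPlace_apply] at h1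
        rw [h1, hγ']
        exact (PiLp.norm_apply_le v.fst _).trans (WithLp.norm_fst_le _ v)
      · have h1 := (mixedEmbedding.normAtPlace_apply_of_isComplex h (mixedEmbedding K (γ : K)))
        rw [mixedEmbedding.normAtPlace_apply] at h1
        rw [h1, hγ']
        exact (PiLp.norm_apply_le v.snd _).trans (WithLp.norm_snd_le _ v)
    have hs := hL γ i (hh.trans_lt hi)
    have hv2 : v = T.symm (mixedEmbedding K (γ : K)) := by rw [hγ']; simp
    rw [hv2]
    let g : K →ₗ[ℚ] mixedEmbedding.euclidean.mixedSpace K :=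
      ((T.symm.toLinearMap.restrictScalars ℚ).comp (mixedEmbedding K).toRatAlgHom.toLinearMap)
    have h3 : g γ ∈ (Submodule.span ℚ (b '' Set.Iio i)).map g := Submodule.mem_map_of_mem hs
    rw [Submodule.map_span, ← Set.image_comp] at h3
    exact Submodule.span_subset_span ℚ ℝ _ h3

end Minkowski

section GoodBasis
variable {F K : Type*} [Field F] [NumberField F] [Field K] [NumberField K] [Algebra F K]

lemma exists_integer_notMem {V : Submodule F K} (hV : V ≠ ⊤) : ∃ γ : 𝓞 K, (γ : K) ∉ V := by
  by_contra! h
  apply hV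
  rw [Submodule.eq_top_iff']
  intro x
  obtain ⟨⟨a, s⟩, hs⟩ :=
    IsLocalization.surj (Algebra.algebraMapSubmonoid (𝓞 K) (nonZeroDivisors ℤ)) x
  obtain ⟨m, hm, hms⟩ := s.2
  have hm0 : (m : F) ≠ 0 := by exact_mod_cast nonZeroDivisors.ne_zero hm
  have h1 : (m : F) • x = (a : K) := by
    rw [Algebra.smul_def, mul_comm]
    refine Eq.trans ?_ hs
    simp [← hms]
  have h2 := V.smul_mem (m : F)⁻¹ (h a)
  rwa [← h1, smul_smul, inv_mul_cancel₀ hm0, one_smul] at h2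

lemma exists_minimal_notMem {V : Submodule F K} (hV : V ≠ ⊤) :
    ∃ γ : 𝓞 K, ∃ i : ℕ, (γ : K) ∉ V ∧ house (γ : K) ≤ 2 ^ i ∧
      (∀ δ : 𝓞 K, (δ : K) ∉ V → ∀ j : ℕ, house (δ : K) ≤ 2 ^ j → i ≤ j) ∧
      (∀ δ : 𝓞 K, house (δ : K) < 2 ^ i / 2 → (δ : K) ∈ V) := by
  have hex : ∃ i : ℕ, ∃ γ : 𝓞 K, (γ : K) ∉ V ∧ house (γ : K) ≤ 2 ^ i := by
    obtain ⟨γ, hγ⟩ := exists_integer_notMem hV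
    obtain ⟨i, hi⟩ := pow_unbounded_of_one_lt (house (γ : K)) one_lt_two
    exact ⟨i, γ, hγ, hi.le⟩
  obtain ⟨γ, h1, h2⟩ := Nat.find_spec hex
  have h3 : ∀ δ : 𝓞 K, (δ : K) ∉ V → ∀ j : ℕ, house (δ : K) ≤ 2 ^ j → Nat.find hex ≤ j :=
    fun δ hδ j hj => Nat.find_min' hex ⟨δ, hδ, hj⟩
  refine ⟨γ, Nat.find hex, h1, h2, h3, ?_⟩
  intro δ hδ
  by_contra hmem
  have hδ0 : δ ≠ 0 := by rintro rfl; simp at hmem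
  have h5 := one_le_house hδ0
  rcases Nat.eq_zero_or_pos (Nat.find hex) with h0 | h0
  · rw [h0] at hδ; norm_num at hδ; linarith
  · have h6 : (2 : ℝ) ^ Nat.find hex / 2 = 2 ^ (Nat.find hex - 1) := by
      obtain ⟨m, hm⟩ := Nat.exists_eq_add_of_lt h0
      rw [hm]; simp [pow_succ]
    rw [h6] at hδ
    have := h3 δ hmem _ hδ.le
    omega

lemma exists_good_triple (h3 : finrank F K = 3) : ∃ α β : 𝓞 K, ∃ i j : ℕ, i ≤ j ∧
    LinearIndependent F ![(1 : K), (α : K), (β : K)] ∧ house (α : K) ≤ 2 ^ i ∧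
    house (β : K) ≤ 2 ^ j ∧
    ((2 : ℝ) ^ (i + j)) ^ (2 * finrank ℚ F) ≤
      64 ^ finrank ℚ F * ((3 * finrank ℚ F : ℕ) : ℝ) ^ (2 * (3 * finrank ℚ F)) *
        |(discr K : ℝ)| := by
  set n := finrank ℚ F with hn
  have hfin : ∀ V : Submodule F K, finrank F V < 3 → V ≠ ⊤ := by
    rintro V hV rfl; rw [finrank_top, h3] at hV; omega
  obtain ⟨α, i, hα, hαi, hαmin, hα2⟩ := exists_minimal_notMem
    (hfin (Submodule.span F {(1 : K)}) ((finrank_span_le_card _).trans_lt (by simp)))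
  obtain ⟨β, j, hβ, hβj, -, hβ2⟩ := exists_minimal_notMem
    (hfin (Submodule.span F {(1 : K), (α : K)})
      ((finrank_span_le_card _).trans_lt (by
        refine (Nat.lt_succ_of_le ?_ : _ < 3)
        rw [← Set.ncard_eq_toFinset_card']
        exact (Set.ncard_insert_le _ _).trans (by simp))))
  have hij : i ≤ j := hαmin β (fun h => hβ (Submodule.span_mono (by simp) h)) j hβj
  refine ⟨α, β, i, j, hij, ?_, hαi, hβj, ?_⟩
  · rw [linearIndependent_finSucc']
    have e1 : Fin.init ![(1 : K), (α : K), (β : K)] = ![(1 : K), (α : K)] := by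
      ext m; fin_cases m <;> rfl
    rw [e1]
    refine ⟨?_, ?_⟩
    · rw [linearIndependent_finSucc']
      have e2 : Fin.init ![(1 : K), (α : K)] = ![(1 : K)] := by
        ext m; fin_cases m; rfl
      rw [e2]
      refine ⟨by simp, ?_⟩
      simpa using hα
    · simpa [Matrix.range_cons, Set.pair_comm] using hβ
  · have hfr : finrank ℚ K = 3 * n := by
      rw [← finrank_mul_finrank ℚ F K, h3, mul_comm]
    set ω := finBasis ℚ F
    set e : Fin 3 → K := ![(1 : K), (α : K), (β : K)] with he
    set ρ : Fin 3 → ℝ := ![1 / 2, 2 ^ i / 2, 2 ^ j / 2] with hρ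
    have hb := prod_le_sqrt_discr K hfr
      (fun m => ω m.modNat • e m.divNat) (fun m => ρ m.divNat) ?_ ?_ ?_
    · have hprod : ∏ m : Fin (3 * n), ρ m.divNat = (2 ^ (i + j) / 8) ^ n := by
        rw [← Equiv.prod_comp finProdFinEquiv, Fintype.prod_prod_type]
        simp only [finProdFinEquiv, Equiv.coe_fn_mk]
        have : ∀ (x : Fin 3) (y : Fin n), (Fin.divNat (finProdFinEquiv (x, y))) = x := by
          intro x y
          exact congrArg Prod.fst (finProdFinEquiv.symm_apply_apply (x, y))
        have h2 : ∀ (x : Fin 3) (y : Fin n), ρ (Fin.divNat (finProdFinEquiv (x, y))) = ρ x := by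
          intro x y; rw [this]
        refine (Finset.prod_congr rfl fun x _ => Finset.prod_congr rfl fun y _ => h2 x y).trans ?_
        simp only [Finset.prod_const, Finset.card_univ, Fintype.card_fin, Fin.prod_univ_three, hρ]
        rw [← mul_pow, ← mul_pow]
        simp; ring
      rw [hprod] at hb
      have h0 : (0 : ℝ) ≤ (2 ^ (i + j) / 8) ^ n := by positivity
      have hsq := mul_self_le_mul_self h0 hb
      rw [mul_mul_mul_comm, Real.mul_self_sqrt (by positivity)] at hsq
      calc ((2 : ℝ) ^ (i + j)) ^ (2 * n)
          = 64 ^ n * ((2 ^ (i + j) / 8) ^ n * (2 ^ (i + j) / 8) ^ n) := by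
            rw [← mul_pow, ← mul_pow, pow_mul]; congr 1; ring
        _ ≤ _ := by
          rw [mul_assoc]
          refine mul_le_mul_of_nonneg_left (hsq.trans_eq ?_) (by positivity)
          push_cast; ring
    · intro m
      have : ∀ t, 0 < ρ t := by intro t; fin_cases t <;> simp [hρ]
      exact this _
    · have hm : Monotone ρ := by
        rw [Fin.monotone_iff_le_succ]
        intro t
        fin_cases t
        · have := one_le_pow₀ (n := i) (one_le_two (α := ℝ)); simp [hρ]; linarith
        · simp [hρ]; gcongr; exact one_le_two
      intro a b hab
      exact hm (Nat.div_le_div_right hab)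
    · intro γ m hm
      have key : ∀ t : Fin 3, house (γ : K) < ρ t →
          (γ : K) ∈ Submodule.span F (e '' Set.Iio t) := by
        intro t ht
        fin_cases t
        · have : γ = 0 := by
            by_contra h0
            have := one_le_house h0
            simp [hρ] at ht
            norm_num at ht
            linarith
          simp [this]
        · refine Submodule.span_mono ?_ (hα2 γ (by simpa [hρ] using ht))
          simp only [Set.singleton_subset_iff]
          exact ⟨0, by simp, rfl⟩
        · refine Submodule.span_mono ?_ (hβ2 γ (by simpa [hρ] using ht))
          rintro _ (rfl | rfl)
          · exact ⟨0, by simp, rfl⟩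
          · exact ⟨1, by simp, rfl⟩
      have h1 := key _ hm
      have h2 := Submodule.span_smul_of_span_eq_top ω.span_eq (e '' Set.Iio m.divNat)
      have h3 : (γ : K) ∈ (Submodule.span F (e '' Set.Iio m.divNat)).restrictScalars ℚ := h1
      rw [← h2] at h3
      refine Submodule.span_mono ?_ h3
      rintro _ ⟨_, ⟨l, rfl⟩, _, ⟨s, hs, rfl⟩, rfl⟩
      refine ⟨finProdFinEquiv (s, l), ?_, ?_⟩
      · have h5 : (finProdFinEquiv (s, l)).divNat = s :=
          congrArg Prod.fst (finProdFinEquiv.symm_apply_apply (s, l))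
        by_contra h
        simp only [Set.mem_Iio, not_lt] at h
        have h6 : m.divNat ≤ (finProdFinEquiv (s, l)).divNat := Nat.div_le_div_right h
        rw [h5] at h6
        exact absurd hs (not_lt.mpr h6)
      · have h5 := finProdFinEquiv.symm_apply_apply (s, l)
        have h6 : (finProdFinEquiv (s, l)).divNat = s := congrArg Prod.fst h5
        have h7 : (finProdFinEquiv (s, l)).modNat = l := congrArg Prod.snd h5
        simp only [h6, h7]

end GoodBasis

section Coordinates

lemma norm_det_le_of_row {κ : Type*} [Fintype κ] (A : Matrix κ κ ℂ) (r : κ → ℝ)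
    (h : ∀ i j, ‖A i j‖ ≤ r i) : ‖A.det‖ ≤ (Fintype.card κ).factorial * ∏ i, r i := by
  rw [Matrix.det_apply]
  refine (norm_sum_le _ _).trans ?_
  calc _ ≤ ∑ σ : Equiv.Perm κ, ∏ i, r i := by
        refine Finset.sum_le_sum fun σ _ => ?_
        rw [← Equiv.prod_comp σ r]
        have h1 : ‖Equiv.Perm.sign σ • ∏ i, A (σ i) i‖ = ∏ i, ‖A (σ i) i‖ := by
          rw [← norm_prod]
          rcases Int.units_eq_one_or (Equiv.Perm.sign σ) with h | h <;> simp [h]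
        rw [h1]
        exact Finset.prod_le_prod (fun _ _ => norm_nonneg _) fun i _ => h _ _
    _ = _ := by
        rw [Finset.sum_const, Finset.card_univ, Fintype.card_perm, nsmul_eq_mul]

variable {K : Type*} [Field K] [NumberField K]

lemma coords_of_prod_le {κ : Type*} [Fintype κ] (b : Basis κ ℚ K)
    (h_int : ∀ i, IsIntegral ℤ (b i)) (R : κ → ℝ) (hR : ∀ i, 0 < R i)
    (hbR : ∀ i, house (b i) ≤ R i) (C : ℝ) (hC : ∏ i, R i ≤ C * √|(discr K : ℝ)|) :
    ∃ δ : ℤ, δ ≠ 0 ∧ |(δ : ℝ)| ≤ (Fintype.card κ).factorial * C ∧ ∀ γ : 𝓞 K,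
      (∀ i, ∃ z : ℤ, δ * b.repr (γ : K) i = z) ∧
      ∀ i, |(b.repr (γ : K) i : ℝ)| ≤
        (Fintype.card κ).factorial * C * (house (γ : K) / R i) := by
  set N := Fintype.card κ with hN
  choose bo hbo using fun i => (⟨⟨b i, h_int i⟩, rfl⟩ : ∃ x : 𝓞 K, (x : K) = b i)
  have e0 : Free.ChooseBasisIndex ℤ (𝓞 K) ≃ κ := (integralBasis K).indexEquiv b
  set B := (RingOfIntegers.basis K).reindex e0 with hB
  set Bq := (integralBasis K).reindex e0 with hBq
  set P : Matrix κ κ ℤ := B.toMatrix bo with hP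
  have hPq : Bq.toMatrix b = P.map (algebraMap ℤ ℚ) := by
    ext k l
    simp only [hBq, hP, hB, Basis.toMatrix_apply, Basis.repr_reindex_apply, Matrix.map_apply]
    rw [← hbo l]
    exact integralBasis_repr_apply K (bo l) _
  have hdet : (Bq.toMatrix b).det = (P.det : ℚ) := by
    rw [hPq]; exact (RingHom.map_det (algebraMap ℤ ℚ) P).symm
  have hdisc : Algebra.discr ℚ b = (P.det : ℚ) ^ 2 * discr K := by
    conv_lhs => rw [← Bq.toMatrix_map_vecMul b, Algebra.discr_of_matrix_vecMul, hdet]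
    rw [hBq, Basis.coe_reindex, Algebra.discr_reindex, coe_discr]
  have hne : Algebra.discr ℚ b ≠ 0 := Algebra.discr_not_zero_of_basis ℚ b
  have hP0 : P.det ≠ 0 := by
    rintro h; rw [h] at hdisc; simp [hne] at hdisc
  have e : κ ≃ (K →ₐ[ℚ] ℂ) := by
    refine Fintype.equivOfCardEq ?_
    rw [AlgHom.card, Module.finrank_eq_card_basis b]
  set M := Algebra.embeddingsMatrixReindex ℚ ℂ b e with hM
  have hMap : ∀ k l, M k l = e l (b k) := fun k l => by
    simp [hM, Algebra.embeddingsMatrixReindex, Algebra.embeddingsMatrix]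
  have hMdet : ((P.det : ℂ)) ^ 2 * (discr K : ℂ) = M.det ^ 2 := by
    rw [hM, ← Algebra.discr_eq_det_embeddingsMatrixReindex_pow_two, hdisc]; simp
  have hMnorm : ‖M.det‖ = |(P.det : ℝ)| * √|(discr K : ℝ)| := by
    have h1 := congrArg norm hMdet
    rw [norm_mul, norm_pow, norm_pow, Complex.norm_intCast, Complex.norm_intCast] at h1
    rw [← sq_eq_sq₀ (norm_nonneg _) (by positivity), ← h1, mul_pow, Real.sq_sqrt (abs_nonneg _)]
  have hd0 : (0 : ℝ) < √|(discr K : ℝ)| := by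
    have := discr_ne_zero K
    positivity
  have hPR : 0 < ∏ i, R i := Finset.prod_pos fun i _ => hR i
  refine ⟨P.det, hP0, ?_, fun γ => ⟨fun k => ?_, fun k => ?_⟩⟩
  · have h1 := norm_det_le_of_row M R fun i j => by
      rw [hMap]; exact ((norm_embedding_le_house (b i) (e j : K →+* ℂ))).trans (hbR i)
    rw [hMnorm] at h1
    have h2 : |(P.det : ℝ)| * √|(discr K : ℝ)| ≤ (N.factorial * C) * √|(discr K : ℝ)| := by
      refine h1.trans ?_
      rw [mul_assoc]; gcongr
    exact le_of_mul_le_mul_right h2 hd0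
  · set y : κ → ℤ := fun l => B.repr γ l with hy
    refine ⟨(P.adjugate.mulVec y) k, ?_⟩
    have hBy : ∀ l, Bq.repr (γ : K) l = (y l : ℚ) := fun l => by
      simp only [hBq, hy, hB, Basis.repr_reindex_apply]
      exact integralBasis_repr_apply K γ _
    have h1 : (Bq.toMatrix b).mulVec (b.repr (γ : K)) = Bq.repr (γ : K) :=
      Basis.toMatrix_mulVec_repr b Bq _
    have h2 := congrArg (fun v => ((Bq.toMatrix b).adjugate.mulVec v) k) h1
    simp only [Matrix.mulVec_mulVec, Matrix.adjugate_mul, hdet] at h2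
    rw [Matrix.smul_mulVec, Matrix.one_mulVec] at h2
    refine Eq.trans (by simp) (h2.trans ?_)
    rw [hPq]
    have h3 : (P.map (algebraMap ℤ ℚ)).adjugate = P.adjugate.map (algebraMap ℤ ℚ) :=
      (RingHom.map_adjugate (algebraMap ℤ ℚ) P).symm
    rw [h3]
    simp [Matrix.mulVec, dotProduct, hBy]
  · have hcr : M.det * (b.repr (γ : K) k : ℂ) =
        (M.updateRow k fun l => e l (γ : K)).det := by
      rw [← Matrix.cramer_transpose_apply, Matrix.cramer_eq_adjugate_mulVec]
      have h1 : (fun l => e l (γ : K)) = M.transpose.mulVec fun k => (b.repr (γ : K) k : ℂ) := by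
        ext l
        conv_lhs => rw [← b.sum_repr (γ : K)]
        simp [Matrix.mulVec, dotProduct, hMap, Algebra.smul_def, mul_comm]
      rw [h1, Matrix.mulVec_mulVec, Matrix.adjugate_mul, Matrix.smul_mulVec, Matrix.one_mulVec]
      simp
    have h1 := norm_det_le_of_row (M.updateRow k fun l => e l (γ : K))
      (Function.update R k (house (γ : K))) fun i j => by
        by_cases hik : i = k
        · subst hik
          simp only [Matrix.updateRow_self, Function.update_self]
          exact norm_embedding_le_house (γ : K) (e j : K →+* ℂ)
        · simp only [Matrix.updateRow_ne hik, Function.update_of_ne hik]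
          rw [hMap]; exact ((norm_embedding_le_house (b i) (e j : K →+* ℂ))).trans (hbR i)
    rw [← hcr, norm_mul, hMnorm, Finset.prod_update_of_mem (Finset.mem_univ k)] at h1
    have h2 : ∏ i ∈ Finset.univ \ {k}, R i = (∏ i, R i) / R k := by
      rw [eq_div_iff (hR k).ne', mul_comm, ← Finset.prod_singleton R k, mul_comm,
        Finset.prod_sdiff (Finset.subset_univ _)]
    rw [h2] at h1
    have h3 : (1 : ℝ) ≤ |(P.det : ℝ)| := by
      exact_mod_cast Int.one_le_abs hP0
    have h4 : ‖(b.repr (γ : K) k : ℂ)‖ = |(b.repr (γ : K) k : ℝ)| := by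
      rw [← Complex.ofReal_ratCast, Complex.norm_real, Real.norm_eq_abs]
    rw [h4] at h1
    have h5 : √|(discr K : ℝ)| * |(b.repr (γ : K) k : ℝ)| ≤
        √|(discr K : ℝ)| * (N.factorial * C * (house (γ : K) / R k)) := by
      calc _ ≤ |(P.det : ℝ)| * √|(discr K : ℝ)| * |(b.repr (γ : K) k : ℝ)| := by
            rw [mul_assoc]
            exact le_mul_of_one_le_left (by positivity) h3
        _ ≤ _ := h1
        _ ≤ N.factorial * (house (γ : K) * (C * √|(discr K : ℝ)| / R k)) := by
            have := house_nonneg (γ : K)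
            have := hR k
            gcongr
        _ = _ := by ring
    exact le_of_mul_le_mul_left h5 hd0

end Coordinates

section RelativeCoordinates

lemma house_algebraMap_le {F K : Type*} [Field F] [NumberField F] [Field K] [NumberField K]
    [Algebra F K] (x : F) : house (algebraMap F K x) ≤ house x := by
  rw [house_le_iff (house_nonneg _)]
  exact fun φ => norm_embedding_le_house x (φ.comp (algebraMap F K))

lemma exists_relative_coords (F : Type*) [Field F] [NumberField F] (C₀ : ℝ) (hC₀ : 0 < C₀) :
    ∃ C : ℝ, 1 ≤ C ∧ ∃ m : ℕ, m ≠ 0 ∧ ∀ (K : Type*) [Field K] [NumberField K] [Algebra F K],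
      ∀ e : Basis (Fin 3) F K, (∀ t, IsIntegral ℤ (e t)) → ∀ ρ : Fin 3 → ℝ, (∀ t, 0 < ρ t) →
      (∀ t, house (e t) ≤ ρ t) → (∏ t, ρ t) ^ finrank ℚ F ≤ C₀ * √|(discr K : ℝ)| →
      ∀ γ : 𝓞 K, ∀ t, ∃ x : 𝓞 F, (x : F) = m * e.repr (γ : K) t ∧
        house (x : F) ≤ C * (house (γ : K) / ρ t) := by
  obtain ⟨c, hc1, -, hc⟩ := exists_coord_bound F
  set n := finrank ℚ F with hn
  set H : ℝ := 1 + ∑ l, house (integralBasis F l) with hH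
  have hH1 : 1 ≤ H := by
    have : 0 ≤ ∑ l, house (integralBasis F l) := Finset.sum_nonneg fun _ _ => house_nonneg _
    linarith
  have hHl : ∀ l, house (integralBasis F l) ≤ H := fun l => by
    have := Finset.single_le_sum (f := fun l => house (integralBasis F l))
      (fun _ _ => house_nonneg _) (Finset.mem_univ l)
    linarith
  set C₁ : ℝ := (n * 3).factorial * (H ^ (n * 3) * C₀) with hC₁
  have hC₁pos : 0 < C₁ := by positivity
  set m : ℕ := (⌊C₁⌋₊).factorial with hm
  have hm0 : m ≠ 0 := Nat.factorial_ne_zero _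
  refine ⟨1 + c * (m * (C₁ / H)), by
    have : 0 ≤ c * (m * (C₁ / H)) := by positivity
    linarith, m, hm0, ?_⟩
  intro K _ _ _ e he ρ hρ heρ hdisc γ t
  set b := (integralBasis F).smulTower e with hb
  have hcard : Fintype.card (Free.ChooseBasisIndex ℤ (𝓞 F) × Fin 3) = n * 3 := by
    rw [Fintype.card_prod, Fintype.card_fin, hn, Module.finrank_eq_card_basis (integralBasis F)]
  obtain ⟨δ, hδ0, hδ, hco⟩ := coords_of_prod_le b (R := fun k => H * ρ k.2)
    (fun k => by
      rw [hb, Basis.smulTower_apply, Algebra.smul_def]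
      refine IsIntegral.mul ?_ (he _)
      rw [integralBasis_apply]
      exact ((RingOfIntegers.basis F k.1).isIntegral_coe).algebraMap)
    (fun k => by have := hρ k.2; positivity)
    (fun k => by
      rw [hb, Basis.smulTower_apply, Algebra.smul_def]
      refine (house_mul_le _ _).trans ?_
      have h1 := (house_algebraMap_le (K := K) (integralBasis F k.1)).trans (hHl k.1)
      have h2 := heρ k.2
      have := house_nonneg (e k.2)
      gcongr)
    (H ^ (n * 3) * C₀) (by
      rw [Finset.prod_mul_distrib, Finset.prod_const, Finset.card_univ, hcard, mul_assoc]
      gcongr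
      rw [Fintype.prod_prod_type_right]
      simp only [Finset.prod_const, Finset.card_univ]
      rw [Finset.prod_pow, ← Module.finrank_eq_card_basis (integralBasis F)]
      exact hdisc)
  rw [hcard, ← hC₁] at hδ hco
  have hdvd : δ ∣ (m : ℤ) := by
    rw [← Int.natAbs_dvd_natAbs, Int.natAbs_natCast]
    refine Nat.dvd_factorial (Int.natAbs_pos.mpr hδ0) (Nat.le_floor ?_)
    rw [Nat.cast_natAbs]; exact_mod_cast hδ
  obtain ⟨q, hq⟩ := hdvd
  have hz : ∀ l, ∃ z : ℤ, (m : ℚ) * b.repr (γ : K) (l, t) = z := by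
    intro l
    obtain ⟨z, hz⟩ := (hco γ).1 (l, t)
    refine ⟨q * z, ?_⟩
    have : (m : ℚ) = δ * q := by exact_mod_cast hq
    rw [this]; push_cast; rw [← hz]; ring
  choose z hz using hz
  set x : 𝓞 F := ∑ l, z l • RingOfIntegers.basis F l with hx
  have hxr : ∀ l, (RingOfIntegers.basis F).repr x l = z l := by
    intro l
    rw [hx]
    exact congrFun ((RingOfIntegers.basis F).repr_sum_self z) l
  have hbr : ∀ l, b.repr (γ : K) (l, t) = (integralBasis F).repr (e.repr (γ : K) t) l := by
    intro l; rw [hb, Basis.smulTower_repr]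
  refine ⟨x, ?_, ?_⟩
  · apply (integralBasis F).repr.injective
    ext l
    rw [integralBasis_repr_apply, hxr]
    have : (m : F) * e.repr (γ : K) t = (m : ℚ) • e.repr (γ : K) t := by
      rw [Algebra.smul_def]; simp
    rw [this, map_smul, Finsupp.smul_apply, ← hbr, smul_eq_mul, hz]
    simp
  · have h1 := hc x (m * (C₁ * (house (γ : K) / (H * ρ t)))) (by
      intro l
      rw [hxr]
      have h2 := (hco γ).2 (l, t)
      have h3 : ((z l : ℤ) : ℝ) = m * (b.repr (γ : K) (l, t) : ℝ) := by
        have := congrArg (fun q : ℚ => (q : ℝ)) (hz l)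
        push_cast at this
        exact this.symm
      rw [h3, abs_mul, Nat.abs_cast]
      gcongr)
    refine h1.trans ?_
    have h4 : c * (m * (C₁ * (house (γ : K) / (H * ρ t)))) =
        c * (m * (C₁ / H)) * (house (γ : K) / ρ t) := by
      field_simp
    rw [h4]
    have := hρ t
    have := house_nonneg (γ : K)
    gcongr
    linarith

end RelativeCoordinates

section CubicForm
open Polynomial
variable {F K : Type*} [Field F] [Field K] [Algebra F K]

/-- The leading coefficient of the binary cubic form attached to a basis `1, α, β`. -/
def formA (e : Basis (Fin 3) F K) : F := e.repr (e 1 * e 1) 2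

/-- The second coefficient of the binary cubic form attached to a basis `1, α, β`. -/
def formB (e : Basis (Fin 3) F K) : F := 2 * e.repr (e 1 * e 2) 2 - e.repr (e 1 * e 1) 1

/-- The third coefficient of the binary cubic form attached to a basis `1, α, β`. -/
def formC (e : Basis (Fin 3) F K) : F := e.repr (e 2 * e 2) 2 - 2 * e.repr (e 1 * e 2) 1

/-- The last coefficient of the binary cubic form attached to a basis `1, α, β`. -/
def formD (e : Basis (Fin 3) F K) : F := -e.repr (e 2 * e 2) 1

/-- The discriminant of the binary cubic form with coefficients `a, b, c, d`. -/
def cubicDisc {R : Type*} [CommRing R] (a b c d : R) : R :=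
  b ^ 2 * c ^ 2 - 4 * a * c ^ 3 - 4 * b ^ 3 * d + 18 * a * b * c * d - 27 * a ^ 2 * d ^ 2

lemma eq_combination (e : Basis (Fin 3) F K) (h0 : e 0 = 1) (x : K) :
    x = algebraMap F K (e.repr x 0) + algebraMap F K (e.repr x 1) * e 1
      + algebraMap F K (e.repr x 2) * e 2 := by
  conv_lhs => rw [← e.sum_repr x]
  simp [Fin.sum_univ_three, h0, Algebra.smul_def]

lemma repr_combination (e : Basis (Fin 3) F K) (h0 : e 0 = 1) {x : K} {u v w : F}
    (hx : x = algebraMap F K u + algebraMap F K v * e 1 + algebraMap F K w * e 2) :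
    e.repr x 0 = u ∧ e.repr x 1 = v ∧ e.repr x 2 = w := by
  have h : x = ∑ i, ![u, v, w] i • e i := by
    simp [Fin.sum_univ_three, h0, Algebra.smul_def, hx]
  have h2 : ∀ i, e.repr x i = ![u, v, w] i := fun i => by
    rw [h, e.repr_sum_self]
  exact ⟨h2 0, h2 1, h2 2⟩

lemma form_relations (e : Basis (Fin 3) F K) (h0 : e 0 = 1) :
    e.repr (e 1 * e 2) 0 = -formA e * formD e - e.repr (e 1 * e 2) 1 * e.repr (e 1 * e 2) 2 ∧
    e.repr (e 1 * e 1) 0 = e.repr (e 1 * e 2) 1 * formA e + e.repr (e 1 * e 2) 2 ^ 2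
      - e.repr (e 1 * e 1) 1 * e.repr (e 1 * e 2) 2 - formA e * e.repr (e 2 * e 2) 2 ∧
    e.repr (e 2 * e 2) 0 = e.repr (e 1 * e 2) 1 ^ 2 - e.repr (e 1 * e 2) 2 * formD e
      + formD e * e.repr (e 1 * e 1) 1 - e.repr (e 2 * e 2) 2 * e.repr (e 1 * e 2) 1 := by
  have h11 := eq_combination e h0 (e 1 * e 1)
  have h12 := eq_combination e h0 (e 1 * e 2)
  have h22 := eq_combination e h0 (e 2 * e 2)
  unfold formA formD
  set l := e.repr (e 1 * e 1) 0
  set p := e.repr (e 1 * e 1) 1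
  set a := e.repr (e 1 * e 1) 2
  set n := e.repr (e 1 * e 2) 0
  set r := e.repr (e 1 * e 2) 1
  set s := e.repr (e 1 * e 2) 2
  set k := e.repr (e 2 * e 2) 0
  set u := e.repr (e 2 * e 2) 1
  set v := e.repr (e 2 * e 2) 2
  have x1 := repr_combination e h0 (x := e 1 * e 1 * e 2) (u := p * n + a * k)
    (v := p * r + a * u) (w := l + p * s + a * v) (by
      simp only [map_add, map_mul]; linear_combination e 2 * h11 + algebraMap F K p * h12
        + algebraMap F K a * h22)
  have x2 := repr_combination e h0 (x := e 1 * e 1 * e 2) (u := r * l + s * n)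
    (v := n + r * p + s * r) (w := r * a + s * s) (by
      simp only [map_add, map_mul]; linear_combination e 1 * h12 + algebraMap F K r * h11
        + algebraMap F K s * h12)
  have y1 := repr_combination e h0 (x := e 1 * e 2 * e 2) (u := u * l + v * n)
    (v := k + u * p + v * r) (w := u * a + v * s) (by
      simp only [map_add, map_mul]; linear_combination e 1 * h22 + algebraMap F K u * h11
        + algebraMap F K v * h12)
  have y2 := repr_combination e h0 (x := e 1 * e 2 * e 2) (u := r * n + s * k)
    (v := r * r + s * u) (w := n + r * s + s * v) (by
      simp only [map_add, map_mul]; linear_combination e 2 * h12 + algebraMap F K r * h12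
        + algebraMap F K s * h22)
  have z1 := x1.2.1.symm.trans x2.2.1
  have z2 := x1.2.2.symm.trans x2.2.2
  have z3 := y1.2.1.symm.trans y2.2.1
  refine ⟨by linear_combination -z1, by linear_combination z2, by linear_combination z3⟩

lemma exists_root (e : Basis (Fin 3) F K) (h0 : e 0 = 1) :
    ∃ θ : K, θ ∉ Set.range (algebraMap F K) ∧
      θ ^ 3 + algebraMap F K (formB e) * θ ^ 2 + algebraMap F K (formA e * formC e) * θ +
        algebraMap F K (formA e ^ 2 * formD e) = 0 := by
  have h11 := eq_combination e h0 (e 1 * e 1)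
  have h12 := eq_combination e h0 (e 1 * e 2)
  obtain ⟨z1, z2, -⟩ := form_relations e h0
  refine ⟨e 1 - algebraMap F K (e.repr (e 1 * e 2) 2), ?_, ?_⟩
  · rintro ⟨y, hy⟩
    have h := repr_combination e h0 (x := e 1) (u := y + e.repr (e 1 * e 2) 2) (v := 0) (w := 0)
      (by rw [map_add, hy]; simp)
    have := h.2.1
    simp at this
  · rw [z1] at h12
    rw [z2] at h11
    unfold formB formC at *
    change e 1 * e 1 = _ + _ + algebraMap F K (formA e) * e 2 at h11
    generalize formA e = a at *
    generalize formD e = d at *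
    simp only [map_add, map_mul, map_sub, map_pow, map_neg, map_ofNat] at *
    generalize algebraMap F K a = a at *
    generalize algebraMap F K d = d at *
    generalize algebraMap F K (e.repr (e 1 * e 1) 1) = p at *
    generalize algebraMap F K (e.repr (e 1 * e 2) 1) = r at *
    generalize algebraMap F K (e.repr (e 1 * e 2) 2) = s at *
    generalize algebraMap F K (e.repr (e 2 * e 2) 2) = v at *
    linear_combination (e 1 - s) * h11 + a * h12

lemma finrank_eq_three (e : Basis (Fin 3) F K) : finrank F K = 3 := by
  rw [finrank_eq_card_basis e, Fintype.card_fin]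

lemma natDegree_minpoly_eq_three (h3 : finrank F K = 3) {θ : K}
    (hθ : θ ∉ Set.range (algebraMap F K)) : (minpoly F θ).natDegree = 3 := by
  have : FiniteDimensional F K := FiniteDimensional.of_finrank_pos (by omega)
  have h1 := minpoly.degree_dvd (K := F) (IsIntegral.of_finite F θ)
  rw [h3] at h1
  rcases (Nat.dvd_prime Nat.prime_three).mp h1 with h | h
  · rw [minpoly.natDegree_eq_one_iff] at h
    exact absurd h hθ
  · exact h

lemma formA_ne_zero (e : Basis (Fin 3) F K) (h0 : e 0 = 1) : formA e ≠ 0 := by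
  intro ha
  have h11 := eq_combination e h0 (e 1 * e 1)
  change e 1 * e 1 = _ + _ + algebraMap F K (formA e) * e 2 at h11
  rw [ha, map_zero (algebraMap F K), zero_mul, add_zero] at h11
  have hθ : e 1 ∉ Set.range (algebraMap F K) := by
    rintro ⟨y, hy⟩
    have h := repr_combination e h0 (x := e 1) (u := y) (v := 0) (w := 0) (by rw [hy]; simp)
    have := h.2.1
    simp at this
  have hdeg := natDegree_minpoly_eq_three (finrank_eq_three e) hθ
  set f : F[X] := X ^ 2 - C (e.repr (e 1 * e 1) 1) * X - C (e.repr (e 1 * e 1) 0) with hf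
  have hfd : f.natDegree = 2 := by rw [hf]; compute_degree!
  have hf0 : f ≠ 0 := by rintro h; rw [h] at hfd; simp at hfd
  have h2 : minpoly F (e 1) ∣ f := minpoly.dvd _ _ (by
    simp only [hf, map_sub, map_pow, aeval_X, map_mul, aeval_C]
    linear_combination h11)
  have := natDegree_le_of_dvd h2 hf0
  omega

lemma discr_eq_cubicDisc (e : Basis (Fin 3) F K) (h0 : e 0 = 1) :
    Algebra.discr F e = cubicDisc (formA e) (formB e) (formC e) (formD e) := by
  have h11 := eq_combination e h0 (e 1 * e 1)
  have h12 := eq_combination e h0 (e 1 * e 2)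
  have h22 := eq_combination e h0 (e 2 * e 2)
  have htr : ∀ x : K, Algebra.trace F K x =
      e.repr (x * e 0) 0 + e.repr (x * e 1) 1 + e.repr (x * e 2) 2 := fun x => by
    rw [Algebra.trace_eq_matrix_trace e, Matrix.trace, Fin.sum_univ_three]
    simp [Algebra.leftMulMatrix_eq_repr_mul]
  have ht0 : Algebra.trace F K 1 = 3 := by
    rw [← map_one (algebraMap F K), Algebra.trace_algebraMap, finrank_eq_three e]; norm_num
  have ht1 : Algebra.trace F K (e 1) = e.repr (e 1 * e 1) 1 + e.repr (e 1 * e 2) 2 := by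
    rw [htr, h0, mul_one]; simp
  have ht2 : Algebra.trace F K (e 2) = e.repr (e 1 * e 2) 1 + e.repr (e 2 * e 2) 2 := by
    rw [htr, h0, mul_one, mul_comm (e 2) (e 1)]; simp
  have hlin : ∀ u v w : F, Algebra.trace F K (algebraMap F K u + algebraMap F K v * e 1 +
      algebraMap F K w * e 2) = 3 * u + v * (e.repr (e 1 * e 1) 1 + e.repr (e 1 * e 2) 2) +
        w * (e.repr (e 1 * e 2) 1 + e.repr (e 2 * e 2) 2) := fun u v w => by
    have hu : algebraMap F K u = u • (1 : K) := Algebra.algebraMap_eq_smul_one u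
    rw [← Algebra.smul_def, ← Algebra.smul_def, hu]
    simp only [map_add, map_smul, ht0, ht1, ht2, smul_eq_mul]
    ring
  have ht11 := (congrArg (Algebra.trace F K) h11).trans (hlin _ _ _)
  have ht12 := (congrArg (Algebra.trace F K) h12).trans (hlin _ _ _)
  have ht22 := (congrArg (Algebra.trace F K) h22).trans (hlin _ _ _)
  obtain ⟨z1, z2, z3⟩ := form_relations e h0
  rw [z1] at ht12
  rw [z2] at ht11
  rw [z3] at ht22
  rw [Algebra.discr_def, Matrix.det_fin_three]
  simp only [Algebra.traceMatrix_apply, Algebra.traceForm_apply, h0, one_mul, mul_one,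
    mul_comm (e 2) (e 1), ht0, ht1, ht2, ht11, ht12, ht22]
  unfold cubicDisc formA formB formC formD
  ring

lemma form_shift (e f : Basis (Fin 3) F K) (h0 : e 0 = 1) (g0 : f 0 = 1) (h1 : f 1 = e 1) (x : F)
    (h2 : f 2 = e 2 + algebraMap F K x * e 1) :
    formA f = formA e ∧ formB f = formB e + 3 * formA e * x := by
  have h11 := eq_combination e h0 (e 1 * e 1)
  have h12 := eq_combination e h0 (e 1 * e 2)
  unfold formA formB
  generalize e.repr (e 1 * e 1) 0 = l at *
  generalize e.repr (e 1 * e 1) 1 = p at *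
  generalize e.repr (e 1 * e 1) 2 = a at *
  generalize e.repr (e 1 * e 2) 0 = n at *
  generalize e.repr (e 1 * e 2) 1 = r at *
  generalize e.repr (e 1 * e 2) 2 = s at *
  have x1 := repr_combination f g0 (x := f 1 * f 1) (u := l) (v := p - a * x) (w := a) (by
    rw [h1, h2, h11, map_sub, map_mul]; ring)
  have x2 := repr_combination f g0 (x := f 1 * f 2) (u := n + x * l)
    (v := r + x * p - x * (s + x * a)) (w := s + x * a) (by
      rw [h1, h2]; simp only [map_add, map_sub, map_mul]
      linear_combination h12 + algebraMap F K x * h11)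
  rw [x1.2.2, x1.2.1, x2.2.2]
  exact ⟨rfl, by ring⟩

lemma minpoly_eq_of_root (h3 : finrank F K = 3) {θ : K} (hθ : θ ∉ Set.range (algebraMap F K))
    {b c d : F} (h : θ ^ 3 + algebraMap F K b * θ ^ 2 + algebraMap F K c * θ +
      algebraMap F K d = 0) : minpoly F θ = X ^ 3 + C b * X ^ 2 + C c * X + C d := by
  have : FiniteDimensional F K := FiniteDimensional.of_finrank_pos (by omega)
  set f : F[X] := X ^ 3 + C b * X ^ 2 + C c * X + C d with hf
  have hfd : f.natDegree = 3 := by rw [hf]; compute_degree!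
  have hfm : f.Monic := by rw [hf]; monicity!
  have h2 : minpoly F θ ∣ f := minpoly.dvd _ _ (by simpa [hf] using h)
  refine (Polynomial.eq_of_monic_of_dvd_of_natDegree_le
    (minpoly.monic (IsIntegral.of_finite F θ)) hfm h2 ?_).symm
  rw [hfd, natDegree_minpoly_eq_three h3 hθ]

lemma adjoin_eq_top_of_notMem (h3 : finrank F K = 3) {θ : K}
    (hθ : θ ∉ Set.range (algebraMap F K)) : IntermediateField.adjoin F {θ} = ⊤ := by
  have : FiniteDimensional F K := FiniteDimensional.of_finrank_pos (by omega)
  rw [Field.primitive_element_iff_minpoly_natDegree_eq, natDegree_minpoly_eq_three h3 hθ, h3]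

lemma nonempty_algEquiv_of_root {L : Type*} [Field L] [Algebra F L] (h3 : finrank F K = 3)
    (h3L : finrank F L = 3) {θ : K} (hθ : θ ∉ Set.range (algebraMap F K)) {θ' : L}
    (hθL : θ' ∉ Set.range (algebraMap F L)) {b c d : F}
    (h : θ ^ 3 + algebraMap F K b * θ ^ 2 + algebraMap F K c * θ + algebraMap F K d = 0)
    (hL : θ' ^ 3 + algebraMap F L b * θ' ^ 2 + algebraMap F L c * θ' + algebraMap F L d = 0) :
    Nonempty (K ≃ₐ[F] L) := by
  have : FiniteDimensional F K := FiniteDimensional.of_finrank_pos (by omega)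
  have : FiniteDimensional F L := FiniteDimensional.of_finrank_pos (by omega)
  have e₁ := IntermediateField.adjoinRootEquivAdjoin F (IsIntegral.of_finite F θ)
  have e₂ := IntermediateField.adjoinRootEquivAdjoin F (IsIntegral.of_finite F θ')
  rw [adjoin_eq_top_of_notMem h3 hθ, minpoly_eq_of_root h3 hθ h] at e₁
  rw [adjoin_eq_top_of_notMem h3L hθL, minpoly_eq_of_root h3L hθL hL] at e₂
  exact ⟨((IntermediateField.topEquiv.symm.trans e₁.symm).trans e₂).trans
    IntermediateField.topEquiv⟩

end CubicForm

section Ramification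
variable {F K : Type*} [Field F] [NumberField F] [Field K] [NumberField K] [Algebra F K]

lemma intTrace_mem_of_pow_mem {p : Ideal (𝓞 F)} [p.IsPrime] (hp : p ≠ ⊥) {y : 𝓞 K}
    {e : ℕ} (hy : y ^ e ∈ p.map (algebraMap (𝓞 F) (𝓞 K))) :
    Algebra.intTrace (𝓞 F) (𝓞 K) y ∈ p := by
  have : p.IsMaximal := Ideal.IsPrime.isMaximal inferInstance hp
  let _ : Field (𝓞 F ⧸ p) := Ideal.Quotient.field p
  rw [← Ideal.Quotient.eq_zero_iff_mem, ← Algebra.trace_quotient_eq_of_isDedekindDomain,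
    ← isNilpotent_iff_eq_zero]
  refine Algebra.isNilpotent_trace_of_isNilpotent ⟨e, ?_⟩
  rw [← map_pow, Ideal.Quotient.eq_zero_iff_mem]
  exact hy

lemma discr_mul_mem_map {κ : Type*} [Fintype κ] [DecidableEq κ] (e : Basis κ F K)
    (he : ∀ t, IsIntegral ℤ (e t))
    {δ : 𝓞 F} (hδ : (δ : F) = Algebra.discr F e) {p : Ideal (𝓞 F)} {y : 𝓞 K}
    (hy : ∀ z : 𝓞 K, Algebra.intTrace (𝓞 F) (𝓞 K) (y * z) ∈ p) :
    algebraMap (𝓞 F) (𝓞 K) δ * y ∈ p.map (algebraMap (𝓞 F) (𝓞 K)) := by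
  choose eo heo using fun i => (⟨⟨e i, he i⟩, rfl⟩ : ∃ x : 𝓞 K, (x : K) = e i)
  have htr : ∀ z : 𝓞 K, ((Algebra.intTrace (𝓞 F) (𝓞 K) z : 𝓞 F) : F) =
      Algebra.trace F K (z : K) := fun z => Algebra.algebraMap_intTrace (K := F) (L := K) z
  set T : Matrix κ κ (𝓞 F) := fun i j => Algebra.intTrace (𝓞 F) (𝓞 K) (eo i * eo j) with hT
  set τ : κ → 𝓞 F := fun s => Algebra.intTrace (𝓞 F) (𝓞 K) (y * eo s) with hτ
  have hTmap : T.map (algebraMap (𝓞 F) F) = Algebra.traceMatrix F e := by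
    ext i j
    rw [Matrix.map_apply, Algebra.traceMatrix_apply, Algebra.traceForm_apply, hT]
    refine (htr _).trans ?_
    rw [← heo i, ← heo j]; simp
  have h1 : (Algebra.traceMatrix F e).mulVec (e.repr (y : K)) = fun s => ((τ s : 𝓞 F) : F) := by
    ext s
    rw [hτ]
    simp only
    rw [htr]
    have : ((y * eo s : 𝓞 K) : K) = ∑ t, e.repr (y : K) t • (e s * e t) := by
      have hmul : ((y * eo s : 𝓞 K) : K) = (y : K) * (eo s : K) :=
        map_mul (algebraMap (𝓞 K) K) _ _
      rw [hmul, heo]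
      conv_lhs => rw [← e.sum_repr (y : K)]
      rw [Finset.sum_mul]
      refine Finset.sum_congr rfl fun t _ => ?_
      rw [smul_mul_assoc, mul_comm (e t)]
    rw [this, map_sum]
    simp [Matrix.mulVec, dotProduct, Algebra.traceMatrix_apply, Algebra.traceForm_apply, mul_comm]
  have h2 : ∀ t, (δ : F) * e.repr (y : K) t = ((T.adjugate.mulVec τ t : 𝓞 F) : F) := by
    intro t
    have h3 := congrArg (fun v => ((Algebra.traceMatrix F e).adjugate.mulVec v) t) h1
    simp only [Matrix.mulVec_mulVec, Matrix.adjugate_mul] at h3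
    rw [Matrix.smul_mulVec, Matrix.one_mulVec, ← Algebra.discr_def, ← hδ] at h3
    refine h3.trans ?_
    rw [← hTmap]
    have h4 : (T.map (algebraMap (𝓞 F) F)).adjugate = T.adjugate.map (algebraMap (𝓞 F) F) :=
      (RingHom.map_adjugate (algebraMap (𝓞 F) F) T).symm
    rw [h4]
    simp [Matrix.mulVec, dotProduct]
  have h5 : algebraMap (𝓞 F) (𝓞 K) δ * y =
      ∑ t, algebraMap (𝓞 F) (𝓞 K) (T.adjugate.mulVec τ t) * eo t := by
    apply RingOfIntegers.coe_injective
    have hc : ∀ z : 𝓞 F, algebraMap (𝓞 K) K (algebraMap (𝓞 F) (𝓞 K) z) =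
        algebraMap F K (z : F) := fun z => rfl
    have heo2 : ∀ t, algebraMap (𝓞 K) K (eo t) = e t := heo
    rw [map_mul, map_sum, hc]
    change _ * (y : K) = _
    conv_lhs => rw [← e.sum_repr (y : K)]
    rw [Finset.mul_sum]
    refine Finset.sum_congr rfl fun t _ => ?_
    rw [map_mul, hc, ← h2, heo2, map_mul, Algebra.smul_def, mul_assoc]
  rw [h5]
  refine Ideal.sum_mem _ fun t _ => Ideal.mul_mem_right _ _ (Ideal.mem_map_of_mem _ ?_)
  exact Ideal.sum_mem _ fun s _ => Ideal.mul_mem_left _ _ (hy _)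

lemma discr_mem_of_partiallyRamified {κ : Type*} [Fintype κ] [DecidableEq κ] (e : Basis κ F K)
    (he : ∀ t, IsIntegral ℤ (e t)) {δ : 𝓞 F} (hδ : (δ : F) = Algebra.discr F e)
    {p : Ideal (𝓞 F)} [p.IsPrime] (hp : p ≠ ⊥) {P₁ P₂ : Ideal (𝓞 K)} (h₁ : P₁.IsPrime)
    (hmap : p.map (algebraMap (𝓞 F) (𝓞 K)) = P₁ ^ 2 * P₂) : δ ∈ p := by
  have hmax : p.IsMaximal := Ideal.IsPrime.isMaximal inferInstance hp
  have hmap0 : p.map (algebraMap (𝓞 F) (𝓞 K)) ≠ ⊥ := Ideal.map_ne_bot_of_ne_bot hp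
  have hP0 : P₁ * P₂ ≠ 0 := by
    intro h
    apply hmap0
    rw [hmap, pow_two, mul_assoc, h, mul_zero, Ideal.zero_eq_bot]
  have hle : Ideal.span {algebraMap (𝓞 F) (𝓞 K) δ} * (P₁ * P₂) ≤ P₁ * (P₁ * P₂) := by
    rw [Ideal.span_singleton_mul_le_iff]
    intro y hy
    have h3 : P₁ * (P₁ * P₂) = p.map (algebraMap (𝓞 F) (𝓞 K)) := by rw [hmap]; ring
    rw [h3]
    refine discr_mul_mem_map e he hδ fun z => intTrace_mem_of_pow_mem hp (e := 2) ?_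
    rw [hmap, mul_pow]
    refine Ideal.mul_mem_right _ _ ?_
    have h4 : y ^ 2 ∈ (P₁ * P₂) ^ 2 := Ideal.pow_mem_pow hy 2
    refine Ideal.mul_mono_right ?_ (by rwa [mul_pow] at h4)
    exact Ideal.pow_le_self two_ne_zero
  have hdvd : P₁ ∣ Ideal.span {algebraMap (𝓞 F) (𝓞 K) δ} :=
    (mul_dvd_mul_iff_right hP0).mp (Ideal.dvd_iff_le.mpr hle)
  have hmem : algebraMap (𝓞 F) (𝓞 K) δ ∈ P₁ := by
    rwa [Ideal.dvd_iff_le, Ideal.span_singleton_le_iff_mem] at hdvd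
  have hcomap : p = P₁.comap (algebraMap (𝓞 F) (𝓞 K)) := by
    refine hmax.eq_of_le (Ideal.comap_ne_top _ h₁.ne_top) ?_
    rw [← Ideal.map_le_iff_le_comap, hmap, pow_two, mul_assoc]
    exact Ideal.mul_le_left (I := P₁) (J := P₁ * P₂)
  rw [hcomap]
  exact hmem

end Ramification

section Forms

lemma exists_scaled_form (F : Type*) [Field F] [NumberField F] (C₀ : ℝ) (hC₀ : 0 < C₀) :
    ∃ C : ℝ, 1 ≤ C ∧ ∃ m : ℕ, m ≠ 0 ∧ ∀ (K : Type*) [Field K] [NumberField K] [Algebra F K],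
      ∀ e : Basis (Fin 3) F K, e 0 = 1 → (∀ t, IsIntegral ℤ (e t)) → ∀ r s : ℝ, 0 < r → 0 < s →
      house (e 1) ≤ r → house (e 2) ≤ s → (r * s) ^ finrank ℚ F ≤ C₀ * √|(discr K : ℝ)| →
      ∃ a b c d : 𝓞 F, (a : F) = m * formA e ∧ (b : F) = m * formB e ∧
        (c : F) = m * formC e ∧ (d : F) = m * formD e ∧
        house (a : F) ≤ C * (r ^ 2 / s) ∧ house (b : F) ≤ C * r ∧
        house (c : F) ≤ C * s ∧ house (d : F) ≤ C * (s ^ 2 / r) := by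
  obtain ⟨C, hC, m, hm, h⟩ := exists_relative_coords F C₀ hC₀
  refine ⟨3 * C, by linarith, m, hm, fun K _ _ _ e h0 he r s hr hs h1 h2 hrs => ?_⟩
  have hC0 : 0 < C := by linarith
  have hρ0 : ∀ t, 0 < (![1, r, s] : Fin 3 → ℝ) t := by
    intro t; fin_cases t <;> simp [hr, hs]
  have hρ1 : ∀ t, house (e t) ≤ (![1, r, s] : Fin 3 → ℝ) t := by
    intro t
    fin_cases t
    · simp [h0, house_le_iff]
    · exact h1
    · exact h2
  have key := h K e he ![1, r, s] hρ0 hρ1 (by simpa [Fin.prod_univ_three] using hrs)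
  choose eo heo using fun i => (⟨⟨e i, he i⟩, rfl⟩ : ∃ x : 𝓞 K, (x : K) = e i)
  have hmul : ∀ t u, ((eo t * eo u : 𝓞 K) : K) = e t * e u := fun t u => by
    rw [← heo t, ← heo u]; exact map_mul (algebraMap (𝓞 K) K) _ _
  have hhouse : ∀ t u, house ((eo t * eo u : 𝓞 K) : K) ≤
      (![1, r, s] : Fin 3 → ℝ) t * (![1, r, s] : Fin 3 → ℝ) u := fun t u => by
    rw [hmul]
    exact (house_mul_le _ _).trans
      (mul_le_mul (hρ1 t) (hρ1 u) (house_nonneg _) (hρ0 t).le)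
  have key2 : ∀ t u w, ∃ x : 𝓞 F, (x : F) = m * e.repr (e t * e u) w ∧
      house (x : F) ≤ C * ((![1, r, s] : Fin 3 → ℝ) t * (![1, r, s] : Fin 3 → ℝ) u /
        (![1, r, s] : Fin 3 → ℝ) w) := by
    intro t u w
    obtain ⟨x, hx, hx2⟩ := key (eo t * eo u) w
    refine ⟨x, by rw [hx, hmul], hx2.trans ?_⟩
    have := hρ0 w
    gcongr
    exact hhouse t u
  obtain ⟨x1, hx1, hb1⟩ := key2 1 1 2
  obtain ⟨x2, hx2, hb2⟩ := key2 1 2 2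
  obtain ⟨x3, hx3, hb3⟩ := key2 1 1 1
  obtain ⟨x4, hx4, hb4⟩ := key2 2 2 2
  obtain ⟨x5, hx5, hb5⟩ := key2 1 2 1
  obtain ⟨x6, hx6, hb6⟩ := key2 2 2 1
  simp only [Matrix.cons_val_one, Matrix.cons_val_zero, Matrix.cons_val, mul_div_assoc,
    div_self hr.ne', div_self hs.ne', mul_one] at hb1 hb2 hb3 hb4 hb5 hb6
  have e2 : ((2 * x2 - x3 : 𝓞 F) : F) = 2 * (x2 : F) - x3 := by
    simp [two_mul]
  have e3 : ((x4 - 2 * x5 : 𝓞 F) : F) = (x4 : F) - 2 * x5 := by simp [two_mul]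
  have e4 : ((-x6 : 𝓞 F) : F) = -(x6 : F) := by simp
  have e5 : r * (s / r) = s := by field_simp
  rw [e5] at hb5
  have hadd := fun x : F => house_add_le x x
  refine ⟨x1, 2 * x2 - x3, x4 - 2 * x5, -x6, hx1, ?_, ?_, ?_, ?_, ?_, ?_, ?_⟩
  · rw [e2, hx2, hx3, formB]; ring
  · rw [e3, hx4, hx5, formC]; ring
  · rw [e4, hx6, formD]; ring
  · refine hb1.trans ?_
    rw [pow_two, mul_div_assoc]
    have : 0 ≤ r * (r / s) := by positivity
    nlinarith
  · rw [e2, two_mul]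
    have := house_sub_le ((x2 : F) + x2) x3
    have := hadd x2
    linarith
  · rw [e3, two_mul]
    have := house_sub_le (x4 : F) (x5 + x5)
    have := hadd x5
    linarith
  · rw [e4, house_neg]
    refine hb6.trans ?_
    rw [pow_two, mul_div_assoc]
    have : 0 ≤ s * (s / r) := by positivity
    nlinarith

variable {F : Type*} [Field F]

/-- The tuple `v` is `m` times the binary cubic form attached to an integral basis of the
`F`-algebra `K` that starts with `1`. -/
def Represents (m : ℕ) (K : Type*) [Field K] [Algebra F K]
    (v : 𝓞 F × 𝓞 F × 𝓞 F × 𝓞 F) : Prop :=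
  ∃ e : Basis (Fin 3) F K, e 0 = 1 ∧ (∀ t, IsIntegral ℤ (e t)) ∧
    (v.1 : F) = m * formA e ∧ (v.2.1 : F) = m * formB e ∧
    (v.2.2.1 : F) = m * formC e ∧ (v.2.2.2 : F) = m * formD e

/-- The discriminant of a binary cubic form given as a tuple of coefficients. -/
def tupleDisc (v : 𝓞 F × 𝓞 F × 𝓞 F × 𝓞 F) : 𝓞 F := cubicDisc v.1 v.2.1 v.2.2.1 v.2.2.2

lemma map_cubicDisc {R S : Type*} [CommRing R] [CommRing S] (f : R →+* S) (a b c d : R) :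
    f (cubicDisc a b c d) = cubicDisc (f a) (f b) (f c) (f d) := by
  simp [cubicDisc, map_ofNat]

lemma coe_tupleDisc (v : 𝓞 F × 𝓞 F × 𝓞 F × 𝓞 F) :
    (tupleDisc v : F) = cubicDisc (v.1 : F) (v.2.1 : F) (v.2.2.1 : F) (v.2.2.2 : F) :=
  map_cubicDisc (algebraMap (𝓞 F) F) _ _ _ _

lemma coe_tupleDisc_eq_discr {K : Type*} [Field K] [Algebra F K] {m : ℕ}
    {v : 𝓞 F × 𝓞 F × 𝓞 F × 𝓞 F} {e : Basis (Fin 3) F K} (h0 : e 0 = 1)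
    (ha : (v.1 : F) = m * formA e) (hb : (v.2.1 : F) = m * formB e)
    (hc : (v.2.2.1 : F) = m * formC e) (hd : (v.2.2.2 : F) = m * formD e) :
    (tupleDisc v : F) = (m : F) ^ 4 * Algebra.discr F e := by
  rw [coe_tupleDisc, ha, hb, hc, hd, discr_eq_cubicDisc e h0]
  simp only [cubicDisc]
  ring

section
variable [NumberField F] {K : Type*} [Field K] [Algebra F K] {m : ℕ} {v : 𝓞 F × 𝓞 F × 𝓞 F × 𝓞 F}

lemma Represents.fst_ne_zero (hm : m ≠ 0) (h : Represents m K v) : v.1 ≠ 0 := by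
  obtain ⟨e, h0, -, ha, -⟩ := h
  intro hz
  rw [hz] at ha
  simp [hm, formA_ne_zero e h0] at ha

lemma Represents.tupleDisc_ne_zero [CharZero K] (hm : m ≠ 0) (h : Represents m K v) :
    tupleDisc v ≠ 0 := by
  obtain ⟨e, h0, -, ha, hb, hc, hd⟩ := h
  have : FiniteDimensional F K := Module.Finite.of_basis e
  intro hz
  have h1 := coe_tupleDisc_eq_discr h0 ha hb hc hd
  rw [hz] at h1
  simp [hm, Algebra.discr_not_zero_of_basis F e] at h1

lemma Represents.tupleDisc_mem [NumberField K] (h : Represents m K v) {p : Ideal (𝓞 F)} [p.IsPrime]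
    (hp : p ≠ ⊥) {P₁ P₂ : Ideal (𝓞 K)} (h₁ : P₁.IsPrime)
    (hmap : p.map (algebraMap (𝓞 F) (𝓞 K)) = P₁ ^ 2 * P₂) : tupleDisc v ∈ p := by
  obtain ⟨e, h0, he, ha, hb, hc, hd⟩ := h
  have h_int : IsIntegral ℤ (Algebra.discr F e) := by
    have : IsIntegral (𝓞 F) (Algebra.discr F e) :=
      Algebra.discr_isIntegral F fun t => (he t).tower_top
    exact isIntegral_trans _ this
  have h1 := coe_tupleDisc_eq_discr h0 ha hb hc hd
  obtain ⟨δ, hδ⟩ : ∃ δ : 𝓞 F, (δ : F) = Algebra.discr F e := ⟨⟨_, h_int⟩, rfl⟩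
  have h2 : δ ∈ p := discr_mem_of_partiallyRamified e he hδ hp h₁ hmap
  have h3 : tupleDisc v = (m : 𝓞 F) ^ 4 * δ := by
    apply RingOfIntegers.coe_injective
    rw [map_mul, map_pow, map_natCast]
    rw [← hδ] at h1
    exact h1
  rw [h3]
  exact Ideal.mul_mem_left _ _ h2

lemma Represents.nonempty_algEquiv {L : Type*} [Field L] [Algebra F L] (hm : m ≠ 0)
    (h : Represents m K v) (hL : Represents m L v) : Nonempty (K ≃ₐ[F] L) := by
  obtain ⟨e, h0, -, ha, hb, hc, hd⟩ := h
  obtain ⟨f, g0, -, ha2, hb2, hc2, hd2⟩ := hL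
  have hmF : (m : F) ≠ 0 := Nat.cast_ne_zero.mpr hm
  have ea := mul_left_cancel₀ hmF (ha.symm.trans ha2)
  have eb := mul_left_cancel₀ hmF (hb.symm.trans hb2)
  have ec := mul_left_cancel₀ hmF (hc.symm.trans hc2)
  have ed := mul_left_cancel₀ hmF (hd.symm.trans hd2)
  obtain ⟨θ, hθ, hr⟩ := exists_root e h0
  obtain ⟨η, hη, hs⟩ := exists_root f g0
  rw [ea, eb, ec, ed] at hr
  exact nonempty_algEquiv_of_root (finrank_eq_three e) (finrank_eq_three f) hθ hη hr hs

end

lemma exists_forms (F : Type*) [Field F] [NumberField F] : ∃ C : ℝ, 1 ≤ C ∧ ∃ m : ℕ, m ≠ 0 ∧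
    ∀ (K : Type*) [Field K] [NumberField K] [Algebra F K], finrank F K = 3 →
    ∃ i j : ℕ, i ≤ j ∧ ((2 : ℝ) ^ (i + j)) ^ (2 * finrank ℚ F) ≤ C * |(discr K : ℝ)| ∧
    ∃ g : 𝓞 F → 𝓞 F × 𝓞 F × 𝓞 F × 𝓞 F, Set.InjOn g {x | house (x : F) ≤ 2 ^ (j - i)} ∧
      ∀ x : 𝓞 F, house (x : F) ≤ 2 ^ (j - i) → Represents m K (g x) ∧
        house ((g x).1 : F) ≤ C * ((2 ^ i) ^ 2 / 2 ^ j) ∧ house ((g x).2.1 : F) ≤ C * 2 ^ i ∧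
        house ((g x).2.2.1 : F) ≤ C * 2 ^ j ∧
        house ((g x).2.2.2 : F) ≤ C * ((2 ^ j) ^ 2 / 2 ^ i) := by
  set n := finrank ℚ F with hn
  have hnpos : 0 < n := finrank_pos
  set M : ℝ := 64 ^ n * ((3 * n : ℕ) : ℝ) ^ (2 * (3 * n)) with hM
  have hMpos : 0 < M := by positivity
  obtain ⟨C, hC, m, hm, h⟩ := exists_scaled_form F (2 ^ n * √M) (by positivity)
  refine ⟨4 * C + M, by linarith, m, hm, fun K _ _ _ h3 => ?_⟩
  obtain ⟨α, β, i, j, hij, hli, hα, hβ, hd⟩ := exists_good_triple (F := F) (K := K) h3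
  refine ⟨i, j, hij, hd.trans ?_, ?_⟩
  · gcongr; linarith
  have hlix : ∀ x : F, LinearIndependent F
      ![(1 : K), (α : K), (β : K) + algebraMap F K x * α] := by
    intro x
    rw [Fintype.linearIndependent_iff] at hli ⊢
    intro w hw
    have h1 := hli ![w 0, w 1 + w 2 * x, w 2] (by
      simp only [Fin.sum_univ_three, Matrix.cons_val_zero, Matrix.cons_val_one, Matrix.cons_val,
        Algebra.smul_def, map_add, map_mul] at hw ⊢
      linear_combination hw)
    have e0 := h1 0
    have e1 := h1 1
    have e2 := h1 2
    simp only [Matrix.cons_val_zero, Matrix.cons_val_one, Matrix.cons_val] at e0 e1 e2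
    rw [e2, zero_mul, add_zero] at e1
    intro t
    fin_cases t
    exacts [e0, e1, e2]
  set E : 𝓞 F → Basis (Fin 3) F K := fun x =>
    basisOfLinearIndependentOfCardEqFinrank (hlix x) (by simp [h3]) with hE
  have hEt : ∀ x, ⇑(E x) = ![(1 : K), (α : K), (β : K) + algebraMap F K x * α] := fun x => by
    simp [hE]
  have hE0 : ∀ x, E x 0 = 1 := fun x => by simp [hEt]
  have hE1 : ∀ x, E x 1 = α := fun x => by simp [hEt]
  have hE2 : ∀ x, E x 2 = β + algebraMap F K x * α := fun x => by simp [hEt]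
  have h_int : ∀ x t, IsIntegral ℤ (E x t) := by
    intro x t
    have hx : IsIntegral ℤ (algebraMap F K x) := x.isIntegral_coe.algebraMap
    fin_cases t
    · exact (hE0 x).symm ▸ isIntegral_one
    · exact (hE1 x).symm ▸ α.isIntegral_coe
    · exact (hE2 x).symm ▸ β.isIntegral_coe.add (hx.mul α.isIntegral_coe)
  have hprod : ((2 : ℝ) ^ i * (2 * 2 ^ j)) ^ n ≤ 2 ^ n * √M * √|(discr K : ℝ)| := by
    have h1 : ((2 : ℝ) ^ (i + j)) ^ n ≤ √(M * |(discr K : ℝ)|) := by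
      apply Real.le_sqrt_of_sq_le
      rw [← pow_mul, mul_comm n 2]
      exact hd
    rw [Real.sqrt_mul hMpos.le] at h1
    calc ((2 : ℝ) ^ i * (2 * 2 ^ j)) ^ n = 2 ^ n * ((2 : ℝ) ^ (i + j)) ^ n := by
          rw [← mul_pow, pow_add]; ring
      _ ≤ 2 ^ n * (√M * √|(discr K : ℝ)|) := by gcongr
      _ = _ := by ring
  have hbd : ∀ x : 𝓞 F, house (x : F) ≤ 2 ^ (j - i) → ∃ v : 𝓞 F × 𝓞 F × 𝓞 F × 𝓞 F,
      ((v.1 : F) = m * formA (E x) ∧ (v.2.1 : F) = m * formB (E x) ∧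
        (v.2.2.1 : F) = m * formC (E x) ∧ (v.2.2.2 : F) = m * formD (E x)) ∧
        house (v.1 : F) ≤ C * ((2 ^ i) ^ 2 / (2 * 2 ^ j)) ∧ house (v.2.1 : F) ≤ C * 2 ^ i ∧
        house (v.2.2.1 : F) ≤ C * (2 * 2 ^ j) ∧
        house (v.2.2.2 : F) ≤ C * ((2 * 2 ^ j) ^ 2 / 2 ^ i) := by
    intro x hx
    have h2 : house (E x 2) ≤ 2 * 2 ^ j := by
      rw [hE2]
      refine (house_add_le _ _).trans ?_
      have h1 : house (algebraMap F K x * (α : K)) ≤ 2 ^ (j - i) * 2 ^ i :=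
        (house_mul_le _ _).trans (mul_le_mul ((house_algebraMap_le _).trans hx) hα
          (house_nonneg _) (by positivity))
      rw [← pow_add, Nat.sub_add_cancel hij] at h1
      linarith
    obtain ⟨a, b, c, d, ha, hb, hc, hd, h⟩ := h K (E x) (hE0 x) (h_int x) (2 ^ i) (2 * 2 ^ j)
      (by positivity) (by positivity) (by rw [hE1]; exact hα) h2 hprod
    exact ⟨(a, b, c, d), ⟨ha, hb, hc, hd⟩, h⟩
  choose! g hg hgb using hbd
  refine ⟨g, fun x hx y hy hxy => ?_, fun x hx => ⟨⟨E x, hE0 x, h_int x, hg x hx⟩, ?_⟩⟩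
  · have hmF : (m : F) ≠ 0 := Nat.cast_ne_zero.mpr hm
    have ea : formB (E x) = formB (E y) := by
      refine mul_left_cancel₀ hmF ?_
      rw [← (hg x hx).2.1, ← (hg y hy).2.1, hxy]
    obtain ⟨-, h2⟩ := form_shift (E x) (E y) (hE0 x) (hE0 y) (by rw [hE1, hE1])
      ((y : F) - x) (by rw [hE2, hE2, hE1, map_sub]; ring)
    rw [← ea, left_eq_add, mul_eq_zero] at h2
    apply RingOfIntegers.coe_injective
    rcases h2 with h2 | h2
    · simp [formA_ne_zero (E x) (hE0 x)] at h2
    · exact (sub_eq_zero.mp h2).symm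
  · obtain ⟨h1, h2, h3, h4⟩ := hgb x hx
    refine ⟨h1.trans ?_, h2.trans ?_, h3.trans ?_, h4.trans ?_⟩
    · gcongr
      · linarith
      · linarith [show (0 : ℝ) < 2 ^ j by positivity]
    · gcongr
      linarith
    · rw [← mul_assoc]
      gcongr
      linarith
    · rw [mul_pow, mul_div_assoc, ← mul_assoc]
      gcongr
      linarith

end Forms

section Counting
variable {F : Type*} [Field F] [NumberField F]

lemma mem_prod_primes {P : Finset (Ideal (𝓞 F))} (hP : ∀ p ∈ P, p.IsPrime ∧ p ≠ ⊥) {x : 𝓞 F}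
    (hx : ∀ p ∈ P, x ∈ p) : x ∈ ∏ p ∈ P, p := by
  rw [← Ideal.dvd_span_singleton]
  refine Finset.prod_primes_dvd _ (fun p hp => ?_) fun p hp => ?_
  · exact Ideal.prime_of_isPrime (hP p hp).2 (hP p hp).1
  · exact Ideal.dvd_span_singleton.mpr (hx p hp)

lemma prod_primes_ne_bot {R : Type*} [CommRing R] [IsDomain R] {P : Finset (Ideal R)}
    (hP : ∀ p ∈ P, p.IsPrime ∧ p ≠ ⊥) :
    ∏ p ∈ P, p ≠ ⊥ :=
  Finset.prod_ne_zero_iff.mpr fun p hp => (hP p hp).2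

lemma absNorm_pos_of_ne_bot {I : Ideal (𝓞 F)} (hI : I ≠ ⊥) : (1 : ℝ) ≤ Ideal.absNorm I := by
  exact_mod_cast Nat.one_le_iff_ne_zero.mpr (Ideal.absNorm_eq_zero_iff.not.mpr hI)

lemma sub_mem_of_cubicDisc_mem {R : Type*} [CommRing R] {p : Ideal R} [hp : p.IsPrime]
    {a b c d₁ d₂ d₃ : R}
    (ha : 3 * a ∉ p) (h₁ : cubicDisc a b c d₁ ∈ p) (h₂ : cubicDisc a b c d₂ ∈ p)
    (h₃ : cubicDisc a b c d₃ ∈ p) (h : d₂ - d₁ ∈ p ↔ d₃ - d₁ ∈ p) : d₂ - d₃ ∈ p := by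
  by_cases h4 : d₂ - d₁ ∈ p
  · have := p.sub_mem h4 (h.mp h4)
    rwa [sub_sub_sub_cancel_right] at this
  · have key : ∀ d, cubicDisc a b c d ∈ p → d - d₁ ∉ p →
        -4 * b ^ 3 + 18 * a * b * c - 27 * a ^ 2 * (d + d₁) ∈ p := by
      intro d hd hdp
      have h5 : (d - d₁) * (-4 * b ^ 3 + 18 * a * b * c - 27 * a ^ 2 * (d + d₁)) ∈ p := by
        have := p.sub_mem hd h₁
        convert this using 1
        simp only [cubicDisc]
        ring
      exact (hp.mem_or_mem h5).resolve_left hdp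
    have h6 := p.sub_mem (key d₃ h₃ (mt h.mpr h4)) (key d₂ h₂ h4)
    have h7 : 3 * ((3 * a) ^ 2 * (d₂ - d₃)) ∈ p := by
      convert h6 using 1
      ring
    have h3 : (3 : R) ∉ p := fun h => ha (p.mul_mem_right _ h)
    exact (hp.mem_or_mem ((hp.mem_or_mem h7).resolve_left h3)).resolve_left
      fun h => ha (hp.mem_of_pow_mem 2 h)

lemma card_last_coeff_le (F : Type*) [Field F] [NumberField F] :
    ∃ C : ℝ, 1 ≤ C ∧ ∀ P : Finset (Ideal (𝓞 F)), (∀ p ∈ P, p.IsPrime ∧ p ≠ ⊥) →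
      ∀ a b c : 𝓞 F, (∀ p ∈ P, 3 * a ∉ p) → ∀ L : ℝ, 0 ≤ L → ∀ S : Finset (𝓞 F),
      (∀ d ∈ S, house (d : F) ≤ L) → (∀ d ∈ S, ∀ p ∈ P, cubicDisc a b c d ∈ p) →
      (S.card : ℝ) ≤ 2 ^ P.card *
        (C * (L ^ finrank ℚ F / Ideal.absNorm (∏ p ∈ P, p) + 1)) := by
  obtain ⟨C, hC, h⟩ := exists_card_le F
  refine ⟨C, hC, fun P hP a b c ha L hL S hS hSP => ?_⟩
  rcases S.eq_empty_or_nonempty with rfl | ⟨d₁, hd₁⟩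
  · simp only [Finset.card_empty, Nat.cast_zero]
    positivity
  have hmaps : Set.MapsTo (fun d => P.filter fun p => d - d₁ ∈ p) (S : Set (𝓞 F))
      (P.powerset : Set (Finset (Ideal (𝓞 F)))) := fun d _ => by
    simp only [Finset.coe_powerset, Set.mem_preimage, Set.mem_powerset_iff, Finset.coe_subset]
    exact Finset.filter_subset _ _
  rw [Finset.card_eq_sum_card_fiberwise hmaps, Nat.cast_sum]
  refine (Finset.sum_le_card_nsmul _ _
    (C * (L ^ finrank ℚ F / Ideal.absNorm (∏ p ∈ P, p) + 1)) fun s _ => ?_).trans ?_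
  · refine h _ (prod_primes_ne_bot hP) L hL _ (fun x hx => hS x (Finset.mem_filter.mp hx).1)
      fun x hx y hy => mem_prod_primes hP fun p hp => ?_
    have := (hP p hp).1
    rw [Finset.mem_filter] at hx hy
    refine sub_mem_of_cubicDisc_mem (ha p hp) (hSP _ hd₁ p hp) (hSP _ hx.1 p hp)
      (hSP _ hy.1 p hp) ?_
    have h1 : p ∈ P.filter (fun p => x - d₁ ∈ p) ↔ p ∈ P.filter (fun p => y - d₁ ∈ p) := by
      rw [hx.2, hy.2]
    simpa [hp] using h1
  · simp [Finset.card_powerset]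

lemma sum_absNorm_le (F : Type*) [Field F] [NumberField F] :
    ∃ C : ℝ, 1 ≤ C ∧ ∀ P : Finset (Ideal (𝓞 F)), (∀ p ∈ P, p.IsPrime ∧ p ≠ ⊥) →
      ∀ A : ℝ, 0 ≤ A → ∀ S : Finset (𝓞 F), (∀ a ∈ S, house (a : F) ≤ A) → (∀ a ∈ S, a ≠ 0) →
      ∑ a ∈ S, (Ideal.absNorm (∏ p ∈ P with 3 * a ∈ p, p) : ℝ) ≤
        2 ^ P.card * (C * A ^ finrank ℚ F) := by
  obtain ⟨C, hC, h⟩ := exists_card_le F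
  set n := finrank ℚ F with hn
  refine ⟨2 * C * 3 ^ n, ?_, fun P hP A hA S hS hS0 => ?_⟩
  · have : (1 : ℝ) ≤ 3 ^ n := one_le_pow₀ (by norm_num)
    nlinarith
  have hmaps : ∀ a ∈ S, (P.filter fun p => 3 * a ∈ p) ∈ P.powerset := fun d _ => by simp
  rw [← Finset.sum_fiberwise_of_maps_to hmaps]
  refine (Finset.sum_le_card_nsmul _ _ (2 * C * 3 ^ n * A ^ n) fun s hs => ?_).trans ?_
  swap
  · simp [Finset.card_powerset]
  have hsP : ∀ p ∈ s, p.IsPrime ∧ p ≠ ⊥ := fun p hp => hP p (Finset.mem_powerset.mp hs hp)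
  set U := S.filter fun a => P.filter (fun p => 3 * a ∈ p) = s with hU
  have h3mem : ∀ a ∈ U, 3 * a ∈ ∏ p ∈ s, p := fun a ha => mem_prod_primes hsP fun p hp => by
    rw [← (Finset.mem_filter.mp ha).2] at hp
    exact (Finset.mem_filter.mp hp).2
  have hsum : ∑ a ∈ U, (Ideal.absNorm (∏ p ∈ P with 3 * a ∈ p, p) : ℝ) =
      U.card * Ideal.absNorm (∏ p ∈ s, p) := by
    rw [← nsmul_eq_mul, ← Finset.sum_const]
    exact Finset.sum_congr rfl fun a ha => by rw [(Finset.mem_filter.mp ha).2]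
  rw [hsum]
  rcases U.eq_empty_or_nonempty with hUe | ⟨a₀, ha₀⟩
  · rw [hUe]
    simp only [Finset.card_empty, Nat.cast_zero, zero_mul]
    positivity
  have hhouse : ∀ a ∈ U, house ((3 * a : 𝓞 F) : F) ≤ 3 * A := fun a ha => by
    have h1 : ((3 * a : 𝓞 F) : F) = (3 : ℕ) * (a : F) := by simp [map_ofNat]
    rw [h1, house_nat_mul]
    have := hS a (Finset.mem_filter.mp ha).1
    push_cast
    linarith
  have hinj : Function.Injective fun a : 𝓞 F => 3 * a := mul_right_injective₀ (by norm_num)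
  have hI := prod_primes_ne_bot hsP
  have hN := absNorm_pos_of_ne_bot hI
  have hcard : (U.card : ℝ) ≤ C * ((3 * A) ^ n / Ideal.absNorm (∏ p ∈ s, p) + 1) := by
    rw [← Finset.card_image_of_injective U hinj]
    refine h _ hI _ (by positivity) _ (fun x hx => ?_) fun x hx y hy => ?_
    · obtain ⟨a, ha, rfl⟩ := Finset.mem_image.mp hx
      exact hhouse a ha
    · obtain ⟨a, ha, rfl⟩ := Finset.mem_image.mp hx
      obtain ⟨b, hb, rfl⟩ := Finset.mem_image.mp hy
      exact Ideal.sub_mem _ (h3mem a ha) (h3mem b hb)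
  have hnorm : (Ideal.absNorm (∏ p ∈ s, p) : ℝ) ≤ (3 * A) ^ n := by
    refine (absNorm_le_house_pow (h3mem a₀ ha₀) ?_).trans
      (pow_le_pow_left₀ (house_nonneg _) (hhouse a₀ ha₀) _)
    exact mul_ne_zero (by norm_num) (hS0 a₀ (Finset.mem_filter.mp ha₀).1)
  calc (U.card : ℝ) * Ideal.absNorm (∏ p ∈ s, p)
      ≤ C * ((3 * A) ^ n / Ideal.absNorm (∏ p ∈ s, p) + 1) * Ideal.absNorm (∏ p ∈ s, p) := by
        gcongr
    _ = C * ((3 * A) ^ n + Ideal.absNorm (∏ p ∈ s, p)) := by field_simp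
    _ ≤ C * ((3 * A) ^ n + (3 * A) ^ n) := by gcongr
    _ = _ := by rw [mul_pow]; ring

lemma four_pow_card_le (F : Type*) [Field F] [NumberField F] :
    ∃ C : ℝ, 1 ≤ C ∧ ∀ P : Finset (Ideal (𝓞 F)), (∀ p ∈ P, p.IsPrime ∧ p ≠ ⊥) →
      (4 : ℝ) ^ P.card ≤ C * (Ideal.absNorm (∏ p ∈ P, p) : ℝ) ^ ((1 : ℝ) / 12) := by
  have hfin : {I : Ideal (𝓞 F) | Ideal.absNorm I ≤ 4 ^ 12}.Finite :=
    Ideal.finite_setOfPred_absNorm_le _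
  refine ⟨4 ^ hfin.toFinset.card, one_le_pow₀ (by norm_num), fun P hP => ?_⟩
  have h1 : ∀ p ∈ P, (4 : ℝ) ≤ (if p ∈ hfin.toFinset then 4 else 1) *
      (Ideal.absNorm p : ℝ) ^ ((1 : ℝ) / 12) := by
    intro p hp
    have hN := absNorm_pos_of_ne_bot (hP p hp).2
    split_ifs with h
    · have := Real.one_le_rpow hN (show (0 : ℝ) ≤ 1 / 12 by norm_num)
      linarith
    · rw [one_mul]
      have h2 : (4 : ℝ) ^ (12 : ℕ) ≤ Ideal.absNorm p := by
        simp only [Set.Finite.mem_toFinset, Set.mem_ofPred_eq, not_le] at h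
        exact_mod_cast h.le
      calc (4 : ℝ) = ((4 : ℝ) ^ (12 : ℕ)) ^ ((1 : ℝ) / 12) := by
            rw [← Real.rpow_natCast, ← Real.rpow_mul (by norm_num)]; norm_num
        _ ≤ _ := Real.rpow_le_rpow (by norm_num) h2 (by norm_num)
  calc (4 : ℝ) ^ P.card = ∏ _p ∈ P, (4 : ℝ) := by rw [Finset.prod_const]
    _ ≤ ∏ p ∈ P, ((if p ∈ hfin.toFinset then 4 else 1) *
        (Ideal.absNorm p : ℝ) ^ ((1 : ℝ) / 12)) :=
      Finset.prod_le_prod (fun _ _ => by norm_num) h1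
    _ = 4 ^ (P.filter (· ∈ hfin.toFinset)).card *
        (Ideal.absNorm (∏ p ∈ P, p) : ℝ) ^ ((1 : ℝ) / 12) := by
      rw [Finset.prod_mul_distrib, map_prod, Nat.cast_prod,
        Real.finsetProd_rpow _ _ fun _ _ => Nat.cast_nonneg _]
      congr 1
      rw [Finset.prod_ite]
      simp
    _ ≤ _ := by
      gcongr
      · norm_num
      · intro p hp
        exact (Finset.mem_filter.mp hp).2

end Counting

section CountingForms

lemma card_forms_le_aux (F : Type*) [Field F] [NumberField F] :
    ∃ C : ℝ, 1 ≤ C ∧ ∀ P : Finset (Ideal (𝓞 F)), (∀ p ∈ P, p.IsPrime ∧ p ≠ ⊥) →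
      ∀ A B G L : ℝ, 0 ≤ A → 1 ≤ B → 1 ≤ G → 0 ≤ L →
      ∀ T : Finset (𝓞 F × 𝓞 F × 𝓞 F × 𝓞 F), (∀ w ∈ T, house (w.1 : F) ≤ A) →
      (∀ w ∈ T, house (w.2.1 : F) ≤ B) → (∀ w ∈ T, house (w.2.2.1 : F) ≤ G) →
      (∀ w ∈ T, house (w.2.2.2 : F) ≤ L) → (∀ w ∈ T, w.1 ≠ 0) →
      (∀ w ∈ T, ∀ p ∈ P, tupleDisc w ∈ p) →
      (T.card : ℝ) ≤ C * 4 ^ P.card * (A * B * G) ^ finrank ℚ F *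
        (L ^ finrank ℚ F / Ideal.absNorm (∏ p ∈ P, p) + 1) := by
  obtain ⟨C₁, hC₁, h1⟩ := exists_card_le F
  obtain ⟨C₂, hC₂, h2⟩ := card_last_coeff_le F
  obtain ⟨C₃, hC₃, h3⟩ := sum_absNorm_le F
  set n := finrank ℚ F with hn
  set C₄ := C₃ + 2 * C₁ with hC₄
  have hC₄1 : 1 ≤ C₄ := by linarith
  refine ⟨(2 * C₁) ^ 2 * C₂ * C₄, ?_, fun P hP A B G L hA hB hG hL T hTA hTB hTG hTL hT0 hTP => ?_⟩
  · exact one_le_mul_of_one_le_of_one_le (one_le_mul_of_one_le_of_one_le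
      (one_le_pow₀ (by linarith)) hC₂) hC₄1
  set N : ℝ := (Ideal.absNorm (∏ p ∈ P, p) : ℝ) with hN
  have hN1 : 1 ≤ N := absNorm_pos_of_ne_bot (prod_primes_ne_bot hP)
  have hbox : ∀ (S : Finset (𝓞 F)) (D : ℝ), 1 ≤ D → (∀ x ∈ S, house (x : F) ≤ D) →
      (S.card : ℝ) ≤ 2 * C₁ * D ^ n := by
    intro S D hD hS
    have := h1 ⊤ top_ne_bot D (by linarith) S hS fun _ _ _ _ => Submodule.mem_top
    rw [Ideal.absNorm_top, Nat.cast_one, div_one] at this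
    have h4 : 1 ≤ D ^ n := one_le_pow₀ hD
    nlinarith
  set SA := T.image fun w => w.1 with hSA
  set SB := T.image fun w => w.2.1 with hSB
  set SG := T.image fun w => w.2.2.1 with hSG
  have hA' : ∀ a ∈ SA, house (a : F) ≤ A := Finset.forall_mem_image.mpr hTA
  have hcB : (SB.card : ℝ) ≤ 2 * C₁ * B ^ n := hbox _ _ hB (Finset.forall_mem_image.mpr hTB)
  have hcG : (SG.card : ℝ) ≤ 2 * C₁ * G ^ n := hbox _ _ hG (Finset.forall_mem_image.mpr hTG)
  have ha0 : ∀ a ∈ SA, a ≠ 0 := by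
    intro a ha
    obtain ⟨w, hw, rfl⟩ := Finset.mem_image.mp ha
    exact hT0 w hw
  have hcA : (SA.card : ℝ) ≤ 2 * C₁ * A ^ n := by
    rcases SA.eq_empty_or_nonempty with he | ⟨a, ha⟩
    · rw [he]
      simp only [Finset.card_empty, Nat.cast_zero]
      positivity
    · exact hbox _ _ ((one_le_house (ha0 a ha)).trans (hA' a ha)) hA'
  set f : 𝓞 F → ℝ := fun a => 2 ^ P.card *
    (C₂ * (L ^ n * (Ideal.absNorm (∏ p ∈ P with 3 * a ∈ p, p) / N) + 1)) with hf
  have hmaps : Set.MapsTo (fun w : 𝓞 F × 𝓞 F × 𝓞 F × 𝓞 F => (w.1, w.2.1, w.2.2.1))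
      (T : Set (𝓞 F × 𝓞 F × 𝓞 F × 𝓞 F)) (SA ×ˢ (SB ×ˢ SG) : Finset (𝓞 F × 𝓞 F × 𝓞 F)) := by
    intro w hw
    simp only [Finset.mem_coe, Finset.mem_product]
    exact ⟨Finset.mem_image_of_mem _ hw, Finset.mem_image_of_mem _ hw,
      Finset.mem_image_of_mem _ hw⟩
  have hfib : ∀ x ∈ SA ×ˢ (SB ×ˢ SG),
      ((T.filter fun w => (w.1, w.2.1, w.2.2.1) = x).card : ℝ) ≤ f x.1 := by
    rintro ⟨a, b, c⟩ -
    set U := T.filter fun w => (w.1, w.2.1, w.2.2.1) = (a, b, c) with hU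
    have hUw : ∀ w ∈ U, w ∈ T ∧ w.1 = a ∧ w.2.1 = b ∧ w.2.2.1 = c := by
      intro w hw
      simpa [hU] using hw
    have hinj : Set.InjOn (fun w : 𝓞 F × 𝓞 F × 𝓞 F × 𝓞 F => w.2.2.2) U := by
      rintro ⟨a1, b1, c1, d1⟩ hx ⟨a2, b2, c2, d2⟩ hy hxy
      obtain ⟨-, h4, h5, h6⟩ := hUw _ hx
      obtain ⟨-, h7, h8, h9⟩ := hUw _ hy
      simp only at *
      rw [h4, h5, h6, h7, h8, h9, hxy]
    rw [← Finset.card_image_of_injOn hinj]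
    have hsplit : (Ideal.absNorm (∏ p ∈ P with 3 * a ∈ p, p) : ℝ) *
        Ideal.absNorm (∏ p ∈ P with ¬ 3 * a ∈ p, p) = N := by
      rw [hN, ← Finset.prod_filter_mul_prod_filter_not P (fun p => 3 * a ∈ p), map_mul,
        Nat.cast_mul]
    have hs1 : (1 : ℝ) ≤ Ideal.absNorm (∏ p ∈ P with 3 * a ∈ p, p) :=
      absNorm_pos_of_ne_bot (prod_primes_ne_bot fun p hp => hP p (Finset.mem_filter.mp hp).1)
    have ht1 : (1 : ℝ) ≤ Ideal.absNorm (∏ p ∈ P with ¬ 3 * a ∈ p, p) :=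
      absNorm_pos_of_ne_bot (prod_primes_ne_bot fun p hp => hP p (Finset.mem_filter.mp hp).1)
    refine (h2 (P.filter fun p => 3 * a ∉ p) (fun p hp => hP p (Finset.mem_filter.mp hp).1) a b c
      (fun p hp => (Finset.mem_filter.mp hp).2) L hL _ ?_ ?_).trans ?_
    · intro d hd
      obtain ⟨w, hw, rfl⟩ := Finset.mem_image.mp hd
      exact hTL w (hUw w hw).1
    · intro d hd p hp
      obtain ⟨w, hw, rfl⟩ := Finset.mem_image.mp hd
      obtain ⟨hwT, rfl, rfl, rfl⟩ := hUw w hw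
      exact hTP w hwT p (Finset.mem_filter.mp hp).1
    · simp only [hf]
      have : L ^ n * ((Ideal.absNorm (∏ p ∈ P with 3 * a ∈ p, p) : ℝ) / N) =
          L ^ n / Ideal.absNorm (∏ p ∈ P with ¬ 3 * a ∈ p, p) := by
        rw [← hsplit]
        field_simp
      rw [this]
      gcongr
      · norm_num
      · exact Finset.filter_subset _ _
  have hsumf : ∑ a ∈ SA, f a ≤ 4 ^ P.card * (C₂ * (C₄ * A ^ n)) * (L ^ n / N + 1) := by
    have h4 := h3 P hP A hA SA hA' ha0
    calc ∑ a ∈ SA, f a = 2 ^ P.card * (C₂ * (L ^ n / N *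
          ∑ a ∈ SA, (Ideal.absNorm (∏ p ∈ P with 3 * a ∈ p, p) : ℝ) + SA.card)) := by
          simp only [hf, ← Finset.mul_sum, Finset.sum_add_distrib, ← Finset.sum_div,
            Finset.sum_const, nsmul_eq_mul, mul_one]
          ring
      _ ≤ 2 ^ P.card * (C₂ * (L ^ n / N * (2 ^ P.card * (C₃ * A ^ n)) +
          2 ^ P.card * (2 * C₁ * A ^ n))) := by
          gcongr
          refine hcA.trans (le_mul_of_one_le_left (by positivity) (one_le_pow₀ (by norm_num)))
      _ = 4 ^ P.card * (C₂ * ((C₃ * (L ^ n / N) + 2 * C₁) * A ^ n)) := by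
          rw [show (4 : ℝ) = 2 * 2 by norm_num, mul_pow]
          ring
      _ ≤ 4 ^ P.card * (C₂ * ((C₄ * (L ^ n / N) + C₄) * A ^ n)) := by
          gcongr <;> linarith
      _ = _ := by ring
  rw [Finset.card_eq_sum_card_fiberwise hmaps, Nat.cast_sum]
  calc ∑ x ∈ SA ×ˢ (SB ×ˢ SG), ((T.filter fun w => (w.1, w.2.1, w.2.2.1) = x).card : ℝ)
      ≤ ∑ x ∈ SA ×ˢ (SB ×ˢ SG), f x.1 := Finset.sum_le_sum hfib
    _ = SB.card * SG.card * ∑ a ∈ SA, f a := by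
        rw [Finset.sum_product]
        simp only [Finset.sum_const, Finset.card_product, nsmul_eq_mul, ← Finset.mul_sum,
          Nat.cast_mul]
    _ ≤ (2 * C₁ * B ^ n) * (2 * C₁ * G ^ n) *
        (4 ^ P.card * (C₂ * (C₄ * A ^ n)) * (L ^ n / N + 1)) := by
        refine mul_le_mul (mul_le_mul hcB hcG (Nat.cast_nonneg _) (by positivity)) hsumf ?_
          (by positivity)
        exact Finset.sum_nonneg fun a _ => by positivity
    _ = _ := by rw [mul_pow, mul_pow]; ring

lemma house_cubicDisc_le {F : Type*} [Field F] [NumberField F] {a b c d : F} {A B G L D : ℝ}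
    (ha : house a ≤ A) (hb : house b ≤ B) (hc : house c ≤ G) (hd : house d ≤ L)
    (h₁ : B ^ 2 * G ^ 2 ≤ D) (h₂ : A * G ^ 3 ≤ D) (h₃ : B ^ 3 * L ≤ D) (h₄ : A * B * G * L ≤ D)
    (h₅ : A ^ 2 * L ^ 2 ≤ D) : house (cubicDisc a b c d) ≤ 54 * D := by
  have hA := (house_nonneg a).trans ha
  have hB := (house_nonneg b).trans hb
  have hG := (house_nonneg c).trans hc
  have hL := (house_nonneg d).trans hd
  have hD : 0 ≤ D := le_trans (by positivity) h₁
  rw [house_le_iff (by positivity)]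
  intro φ
  replace ha := (norm_embedding_le_house a φ).trans ha
  replace hb := (norm_embedding_le_house b φ).trans hb
  replace hc := (norm_embedding_le_house c φ).trans hc
  replace hd := (norm_embedding_le_house d φ).trans hd
  rw [map_cubicDisc φ, cubicDisc]
  have e1 : ‖φ b ^ 2 * φ c ^ 2‖ ≤ D := by
    rw [norm_mul, norm_pow, norm_pow]; exact le_trans (by gcongr) h₁
  have e2 : ‖4 * φ a * φ c ^ 3‖ ≤ 4 * D := by
    rw [norm_mul, norm_mul, norm_pow, mul_assoc, Complex.norm_ofNat]
    exact mul_le_mul_of_nonneg_left (le_trans (by gcongr) h₂) (by norm_num)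
  have e3 : ‖4 * φ b ^ 3 * φ d‖ ≤ 4 * D := by
    rw [norm_mul, norm_mul, norm_pow, mul_assoc, Complex.norm_ofNat]
    exact mul_le_mul_of_nonneg_left (le_trans (by gcongr) h₃) (by norm_num)
  have e4 : ‖18 * φ a * φ b * φ c * φ d‖ ≤ 18 * D := by
    rw [show 18 * φ a * φ b * φ c * φ d = 18 * (φ a * φ b * φ c * φ d) by ring, norm_mul,
      norm_mul, norm_mul, norm_mul, Complex.norm_ofNat]
    exact mul_le_mul_of_nonneg_left (le_trans (by gcongr) h₄) (by norm_num)
  have e5 : ‖27 * φ a ^ 2 * φ d ^ 2‖ ≤ 27 * D := by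
    rw [norm_mul, norm_mul, norm_pow, norm_pow, mul_assoc, Complex.norm_ofNat]
    exact mul_le_mul_of_nonneg_left (le_trans (by gcongr) h₅) (by norm_num)
  refine (norm_sub_le _ _).trans ?_
  have f1 := norm_add_le (φ b ^ 2 * φ c ^ 2 - 4 * φ a * φ c ^ 3 - 4 * φ b ^ 3 * φ d)
    (18 * φ a * φ b * φ c * φ d)
  have f2 := norm_sub_le (φ b ^ 2 * φ c ^ 2 - 4 * φ a * φ c ^ 3) (4 * φ b ^ 3 * φ d)
  have f3 := norm_sub_le (φ b ^ 2 * φ c ^ 2) (4 * φ a * φ c ^ 3)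
  linarith

lemma card_forms_le (F : Type*) [Field F] [NumberField F] (C₁ : ℝ) (hC₁ : 1 ≤ C₁) :
    ∃ C : ℝ, 1 ≤ C ∧ ∀ P : Finset (Ideal (𝓞 F)), (∀ p ∈ P, p.IsPrime ∧ p ≠ ⊥) →
      ∀ u v : ℝ, 1 ≤ u → u ≤ v →
      ∀ T : Finset (𝓞 F × 𝓞 F × 𝓞 F × 𝓞 F), (∀ w ∈ T, house (w.1 : F) ≤ C₁ * (u ^ 2 / v)) →
      (∀ w ∈ T, house (w.2.1 : F) ≤ C₁ * u) → (∀ w ∈ T, house (w.2.2.1 : F) ≤ C₁ * v) →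
      (∀ w ∈ T, house (w.2.2.2 : F) ≤ C₁ * (v ^ 2 / u)) → (∀ w ∈ T, w.1 ≠ 0) →
      (∀ w ∈ T, tupleDisc w ≠ 0) → (∀ w ∈ T, ∀ p ∈ P, tupleDisc w ∈ p) →
      (T.card : ℝ) ≤ C * ((u * v) ^ (2 * finrank ℚ F) *
        (Ideal.absNorm (∏ p ∈ P, p) : ℝ) ^ (-(1 : ℝ) / 6)) := by
  obtain ⟨C₂, hC₂, h2⟩ := card_forms_le_aux F
  obtain ⟨C₃, hC₃, h3⟩ := four_pow_card_le F
  set n := finrank ℚ F with hn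
  set Q : ℝ := (54 * C₁ ^ 4) ^ n with hQ
  have hQ1 : 1 ≤ Q := one_le_pow₀ (by nlinarith [one_le_pow₀ hC₁ (n := 4)])
  set R : ℝ := (C₁ ^ 4) ^ n with hR
  have hR1 : 1 ≤ R := one_le_pow₀ (one_le_pow₀ hC₁)
  refine ⟨C₂ * C₃ * (R * (1 + Q)), ?_, fun P hP u v hu huv T hTA hTB hTG hTL hT0 hTd hTP => ?_⟩
  · exact one_le_mul_of_one_le_of_one_le (one_le_mul_of_one_le_of_one_le hC₂ hC₃)
      (one_le_mul_of_one_le_of_one_le hR1 (by linarith))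
  have hu0 : 0 < u := by linarith
  have hv : 1 ≤ v := hu.trans huv
  have hv0 : 0 < v := by linarith
  have hC0 : 0 < C₁ := by linarith
  set N : ℝ := (Ideal.absNorm (∏ p ∈ P, p) : ℝ) with hN
  have hN1 : 1 ≤ N := absNorm_pos_of_ne_bot (prod_primes_ne_bot hP)
  have hN0 : 0 < N := by linarith
  rcases T.eq_empty_or_nonempty with rfl | ⟨w, hw⟩
  · simp only [Finset.card_empty, Nat.cast_zero]
    positivity
  set W : ℝ := (u * v) ^ (2 * n) with hW
  have hW0 : 0 < W := by positivity
  have hNW : N ≤ Q * W := by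
    refine (absNorm_le_house_pow (mem_prod_primes hP (hTP w hw)) (hTd w hw)).trans ?_
    have hd : house (tupleDisc w : F) ≤ 54 * (C₁ ^ 4 * (u * v) ^ 2) := by
      rw [coe_tupleDisc]
      refine house_cubicDisc_le (hTA w hw) (hTB w hw) (hTG w hw) (hTL w hw) ?_ ?_ ?_ ?_ ?_ <;>
      · apply le_of_eq
        field_simp
    refine (pow_le_pow_left₀ (house_nonneg _) hd n).trans_eq ?_
    rw [hQ, hW, pow_mul, ← mul_pow]
    ring
  have hcard := h2 P hP (C₁ * (u ^ 2 / v)) (C₁ * u) (C₁ * v) (C₁ * (v ^ 2 / u)) (by positivity)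
    (one_le_mul_of_one_le_of_one_le hC₁ hu) (one_le_mul_of_one_le_of_one_le hC₁ hv)
    (by positivity) T hTA hTB hTG hTL hT0 hTP
  have hABG : (C₁ * (u ^ 2 / v) * (C₁ * u) * (C₁ * v)) ^ n = (C₁ ^ 3) ^ n * u ^ (3 * n) := by
    rw [pow_mul, ← mul_pow]
    congr 1
    field_simp
  have hprod : (C₁ ^ 3) ^ n * u ^ (3 * n) * (C₁ * (v ^ 2 / u)) ^ n = R * W := by
    have h4 : C₁ ^ 3 * u ^ 3 * (C₁ * (v ^ 2 / u)) = C₁ ^ 4 * (u * v) ^ 2 := by field_simp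
    rw [hR, hW, pow_mul u, pow_mul (u * v), ← mul_pow, ← mul_pow, h4, mul_pow]
  have hu3 : u ^ (3 * n) ≤ Q * W * N ^ (-(1 : ℝ) / 4) := by
    have h4 : u ^ (3 * n) ≤ W ^ ((3 : ℝ) / 4) := by
      have : (u * u) ^ (2 * n) ≤ W := by rw [hW]; gcongr
      calc u ^ (3 * n) = ((u * u) ^ (2 * n)) ^ ((3 : ℝ) / 4) := by
            rw [← pow_two, ← pow_mul, ← Real.rpow_natCast, ← Real.rpow_natCast,
              ← Real.rpow_mul hu0.le]
            congr 1
            push_cast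
            ring
        _ ≤ _ := Real.rpow_le_rpow (by positivity) this (by norm_num)
    have h5 : W ^ ((3 : ℝ) / 4) = W * W ^ (-(1 : ℝ) / 4) := by
      rw [← Real.rpow_one_add' hW0.le (by norm_num)]
      norm_num
    have h6 : W ^ (-(1 : ℝ) / 4) ≤ Q * N ^ (-(1 : ℝ) / 4) := by
      have h7 : (Q * W) ^ (-(1 : ℝ) / 4) ≤ N ^ (-(1 : ℝ) / 4) :=
        Real.rpow_le_rpow_of_nonpos hN0 hNW (by norm_num)
      have h8 : Q ^ (-(1 : ℝ)) ≤ Q ^ (-(1 : ℝ) / 4) :=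
        Real.rpow_le_rpow_of_exponent_le hQ1 (by norm_num)
      rw [Real.mul_rpow (by positivity) hW0.le] at h7
      rw [Real.rpow_neg_one] at h8
      have h9 : Q⁻¹ * W ^ (-(1 : ℝ) / 4) ≤ N ^ (-(1 : ℝ) / 4) :=
        le_trans (by gcongr) h7
      rwa [inv_mul_le_iff₀ (by positivity)] at h9
    calc u ^ (3 * n) ≤ W * W ^ (-(1 : ℝ) / 4) := h5 ▸ h4
      _ ≤ W * (Q * N ^ (-(1 : ℝ) / 4)) := by gcongr
      _ = _ := by ring
  have hNinv : 1 / N ≤ N ^ (-(1 : ℝ) / 4) := by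
    rw [one_div, ← Real.rpow_neg_one]
    exact Real.rpow_le_rpow_of_exponent_le hN1 (by norm_num)
  have hCR : (C₁ ^ 3) ^ n ≤ R := by
    rw [hR]
    gcongr
    norm_num
  calc (T.card : ℝ) ≤ C₂ * 4 ^ P.card * ((C₁ ^ 3) ^ n * u ^ (3 * n)) *
        ((C₁ * (v ^ 2 / u)) ^ n / N + 1) := by rw [← hABG]; exact hcard
    _ = C₂ * 4 ^ P.card * (R * W * (1 / N) + (C₁ ^ 3) ^ n * u ^ (3 * n)) := by
        rw [← hprod]; ring
    _ ≤ C₂ * (C₃ * N ^ ((1 : ℝ) / 12)) * (R * W * N ^ (-(1 : ℝ) / 4) +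
        R * (Q * W * N ^ (-(1 : ℝ) / 4))) := by
        gcongr
        exact h3 P hP
    _ = C₂ * C₃ * (R * (1 + Q)) * (W * (N ^ ((1 : ℝ) / 12) * N ^ (-(1 : ℝ) / 4))) := by ring
    _ = _ := by
        rw [← Real.rpow_add hN0]
        norm_num

end CountingForms

section Families

lemma card_cell_le (F : Type*) [Field F] [NumberField F] (C₁ : ℝ) (hC₁ : 1 ≤ C₁) (m : ℕ)
    (hm : m ≠ 0) : ∃ C : ℝ, 0 < C ∧ ∀ P : Finset (Ideal (𝓞 F)), (∀ p ∈ P, p.IsPrime ∧ p ≠ ⊥) →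
      ∀ {ι : Type*} (K : ι → Type*) [∀ t, Field (K t)] [∀ t, NumberField (K t)]
      [∀ t, Algebra F (K t)] (S : Finset ι) (i j : ℕ) (g : ι → 𝓞 F → 𝓞 F × 𝓞 F × 𝓞 F × 𝓞 F),
      i ≤ j → (∀ t ∈ S, Set.InjOn (g t) {x | house (x : F) ≤ 2 ^ (j - i)}) →
      (∀ t ∈ S, ∀ x : 𝓞 F, house (x : F) ≤ 2 ^ (j - i) → Represents m (K t) (g t x) ∧
        house ((g t x).1 : F) ≤ C₁ * ((2 ^ i) ^ 2 / 2 ^ j) ∧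
        house ((g t x).2.1 : F) ≤ C₁ * 2 ^ i ∧ house ((g t x).2.2.1 : F) ≤ C₁ * 2 ^ j ∧
        house ((g t x).2.2.2 : F) ≤ C₁ * ((2 ^ j) ^ 2 / 2 ^ i)) →
      (∀ t ∈ S, ∀ p ∈ P, ∃ P₁ P₂ : Ideal (𝓞 (K t)), P₁.IsPrime ∧
        p.map (algebraMap (𝓞 F) (𝓞 (K t))) = P₁ ^ 2 * P₂) →
      (∀ t ∈ S, ∀ t' ∈ S, Nonempty (K t ≃ₐ[F] K t') → t = t') →
      (S.card : ℝ) ≤ C * (Ideal.absNorm (∏ p ∈ P, p) : ℝ) ^ (-(1 : ℝ) / 6) *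
        (((2 : ℝ) ^ (2 * finrank ℚ F)) ^ (i + j) * (1 / 2) ^ (j - i)) := by
  obtain ⟨C₂, hC₂, h2⟩ := card_forms_le F C₁ hC₁
  obtain ⟨c, hc, hbox⟩ := exists_card_ge F
  set n := finrank ℚ F with hn
  have hnpos : 0 < n := finrank_pos
  refine ⟨C₂ / c, by positivity, fun P hP ι K _ _ _ S i j g hij hinj hg hram hiso => ?_⟩
  obtain ⟨B, hB, hBc⟩ := hbox (2 ^ (j - i)) (by positivity)
  set f : ι × 𝓞 F → 𝓞 F × 𝓞 F × 𝓞 F × 𝓞 F := fun y => g y.1 y.2 with hf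
  have hfinj : Set.InjOn f (S ×ˢ B : Finset (ι × 𝓞 F)) := by
    rintro ⟨t, x⟩ htx ⟨t', x'⟩ htx' h
    simp only [Finset.coe_product, Set.mem_prod, Finset.mem_coe] at htx htx'
    simp only [hf] at h
    have h3 := (hg t htx.1 x (hB x htx.2)).1
    rw [h] at h3
    obtain rfl := hiso t htx.1 t' htx'.1
      (h3.nonempty_algEquiv hm (hg t' htx'.1 x' (hB x' htx'.2)).1)
    rw [hinj t htx.1 (hB x htx.2) (hB x' htx'.2) h]
  have hmem : ∀ w ∈ (S ×ˢ B).image f, ∃ t ∈ S, ∃ x : 𝓞 F, house (x : F) ≤ 2 ^ (j - i) ∧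
      g t x = w := by
    intro w hw
    obtain ⟨⟨t, x⟩, htx, rfl⟩ := Finset.mem_image.mp hw
    rw [Finset.mem_product] at htx
    exact ⟨t, htx.1, x, hB x htx.2, rfl⟩
  have hcard := h2 P hP (2 ^ i) (2 ^ j) (one_le_pow₀ (by norm_num))
    (pow_le_pow_right₀ (by norm_num) hij) ((S ×ˢ B).image f) (fun w hw => ?_) (fun w hw => ?_)
    (fun w hw => ?_) (fun w hw => ?_) (fun w hw => ?_) (fun w hw => ?_) (fun w hw p hp => ?_)
  rotate_left
  · obtain ⟨t, ht, x, hx, rfl⟩ := hmem w hw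
    exact (hg t ht x hx).2.1
  · obtain ⟨t, ht, x, hx, rfl⟩ := hmem w hw
    exact (hg t ht x hx).2.2.1
  · obtain ⟨t, ht, x, hx, rfl⟩ := hmem w hw
    exact (hg t ht x hx).2.2.2.1
  · obtain ⟨t, ht, x, hx, rfl⟩ := hmem w hw
    exact (hg t ht x hx).2.2.2.2
  · obtain ⟨t, ht, x, hx, rfl⟩ := hmem w hw
    exact (hg t ht x hx).1.fst_ne_zero hm
  · obtain ⟨t, ht, x, hx, rfl⟩ := hmem w hw
    exact (hg t ht x hx).1.tupleDisc_ne_zero hm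
  · obtain ⟨t, ht, x, hx, rfl⟩ := hmem w hw
    obtain ⟨P₁, P₂, h₁, hmap⟩ := hram t ht p hp
    have := (hP p hp).1
    exact (hg t ht x hx).1.tupleDisc_mem (hP p hp).2 h₁ hmap
  rw [Finset.card_image_of_injOn hfinj, Finset.card_product, Nat.cast_mul] at hcard
  set N : ℝ := (Ideal.absNorm (∏ p ∈ P, p) : ℝ) with hN
  have h5 : (S.card : ℝ) * (c * (2 ^ (j - i)) ^ n) ≤
      C₂ * ((2 ^ i * 2 ^ j) ^ (2 * n) * N ^ (-(1 : ℝ) / 6)) :=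
    le_trans (by gcongr) hcard
  have h6 : (2 : ℝ) ^ (j - i) ≤ (2 ^ (j - i)) ^ n :=
    le_self_pow₀ (one_le_pow₀ (by norm_num)) hnpos.ne'
  have h7 : (S.card : ℝ) * (c * 2 ^ (j - i)) ≤
      C₂ * ((2 ^ i * 2 ^ j) ^ (2 * n) * N ^ (-(1 : ℝ) / 6)) :=
    le_trans (by gcongr) h5
  rw [← le_div_iff₀ (by positivity)] at h7
  refine h7.trans_eq ?_
  rw [one_div, inv_pow, ← pow_add, ← pow_mul, ← pow_mul, mul_comm (i + j)]
  field_simp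

lemma sum_range_pow_le {q : ℝ} (hq : 2 ≤ q) (M : ℕ) :
    ∑ s ∈ Finset.range (M + 1), q ^ s ≤ 2 * q ^ M := by
  induction M with
  | zero => simp
  | succ M ih =>
    rw [Finset.sum_range_succ, pow_succ]
    have : 0 ≤ q ^ M := by positivity
    nlinarith

lemma card_family_le (F : Type*) [Field F] [NumberField F] :
    ∃ C : ℝ, 0 < C ∧ ∀ P : Finset (Ideal (𝓞 F)), (∀ p ∈ P, p.IsPrime ∧ p ≠ ⊥) →
      ∀ {ι : Type*} (K : ι → Type*) [∀ t, Field (K t)] [∀ t, NumberField (K t)]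
      [∀ t, Algebra F (K t)] (S : Finset ι) (X : ℝ), 0 ≤ X → (∀ t, finrank F (K t) = 3) →
      (∀ t ∈ S, |(discr (K t) : ℝ)| ≤ X) →
      (∀ t ∈ S, ∀ p ∈ P, ∃ P₁ P₂ : Ideal (𝓞 (K t)), P₁.IsPrime ∧
        p.map (algebraMap (𝓞 F) (𝓞 (K t))) = P₁ ^ 2 * P₂) →
      (∀ t ∈ S, ∀ t' ∈ S, Nonempty (K t ≃ₐ[F] K t') → t = t') →
      (S.card : ℝ) ≤ C * X * (Ideal.absNorm (∏ p ∈ P, p) : ℝ) ^ (-(1 : ℝ) / 6) := by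
  obtain ⟨C₁, hC₁, m, hm, h1⟩ := exists_forms F
  obtain ⟨C₂, hC₂, h2⟩ := card_cell_le F C₁ hC₁ m hm
  set n := finrank ℚ F with hn
  have hnpos : 0 < n := finrank_pos
  refine ⟨4 * C₂ * C₁, by positivity, fun P hP ι K _ _ _ S X hX h3 hdisc hram hiso => ?_⟩
  set R : ℝ := (Ideal.absNorm (∏ p ∈ P, p) : ℝ) ^ (-(1 : ℝ) / 6) with hR
  have hR0 : 0 ≤ R := by positivity
  choose i j hij hij2 g hg hg2 using fun t => h1 (K t) (h3 t)
  rcases S.eq_empty_or_nonempty with rfl | hSne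
  · simp only [Finset.card_empty, Nat.cast_zero]
    positivity
  obtain ⟨t₀, ht₀, hmax⟩ := S.exists_max_image (fun t => i t + j t) hSne
  set M := i t₀ + j t₀ with hM
  set Q : ℝ := 2 ^ (2 * n) with hQ
  have hQ2 : 2 ≤ Q := le_self_pow₀ (by norm_num) (by omega)
  have hmaps : Set.MapsTo (fun t => (i t + j t, j t - i t)) (S : Set ι)
      (Finset.range (M + 1) ×ˢ Finset.range (M + 1) : Finset (ℕ × ℕ)) := by
    intro t ht
    have := hmax t ht
    simp only [Finset.coe_product, Finset.coe_range, Set.mem_prod, Set.mem_Iio]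
    omega
  have hfib : ∀ x ∈ Finset.range (M + 1) ×ˢ Finset.range (M + 1),
      ((S.filter fun t => (i t + j t, j t - i t) = x).card : ℝ) ≤
        C₂ * R * (Q ^ x.1 * (1 / 2) ^ x.2) := by
    rintro ⟨s, d⟩ -
    set U := S.filter fun t => (i t + j t, j t - i t) = (s, d) with hU
    rcases U.eq_empty_or_nonempty with he | ⟨t₁, ht₁⟩
    · rw [he]
      simp only [Finset.card_empty, Nat.cast_zero]
      positivity
    have hUt : ∀ t ∈ U, t ∈ S ∧ i t + j t = s ∧ j t - i t = d := by
      intro t ht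
      simpa [hU] using ht
    have hit : ∀ t ∈ U, i t = i t₁ ∧ j t = j t₁ := by
      intro t ht
      have := hUt t ht
      have := hUt t₁ ht₁
      have := hij t
      have := hij t₁
      omega
    obtain ⟨-, hs, hd⟩ := hUt t₁ ht₁
    have := h2 P hP K U (i t₁) (j t₁) g (hij t₁)
      (fun t ht => by rw [← (hit t ht).1, ← (hit t ht).2]; exact hg t)
      (fun t ht => by rw [← (hit t ht).1, ← (hit t ht).2]; exact hg2 t)
      (fun t ht => hram t (hUt t ht).1)
      (fun t ht t' ht' => hiso t (hUt t ht).1 t' (hUt t' ht').1)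
    rw [hs, hd] at this
    exact this
  have hQM : Q ^ M ≤ C₁ * X := by
    rw [hQ, pow_right_comm]
    exact (hij2 t₀).trans (by gcongr; exact hdisc t₀ ht₀)
  rw [Finset.card_eq_sum_card_fiberwise hmaps, Nat.cast_sum]
  calc ∑ x ∈ Finset.range (M + 1) ×ˢ Finset.range (M + 1),
        ((S.filter fun t => (i t + j t, j t - i t) = x).card : ℝ)
      ≤ ∑ x ∈ Finset.range (M + 1) ×ˢ Finset.range (M + 1),
        C₂ * R * (Q ^ x.1 * (1 / 2) ^ x.2) := Finset.sum_le_sum hfib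
    _ = C₂ * R * ((∑ s ∈ Finset.range (M + 1), Q ^ s) *
        ∑ d ∈ Finset.range (M + 1), (1 / 2 : ℝ) ^ d) := by
        rw [← Finset.mul_sum, Finset.sum_mul_sum, Finset.sum_product]
    _ ≤ C₂ * R * (2 * Q ^ M * 2) := by
        gcongr
        · exact sum_range_pow_le hQ2 M
        · exact sum_geometric_two_le _
    _ ≤ C₂ * R * (2 * (C₁ * X) * 2) := by gcongr
    _ = _ := by ring

lemma prod_normalizedFactors_of_squarefree {R : Type*} [CommRing R] [IsDedekindDomain R]
    {q : Ideal R} (hq : Squarefree q) :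
    ∏ p ∈ (UniqueFactorizationMonoid.normalizedFactors q).toFinset, p = q := by
  have h0 : q ≠ ⊥ := hq.ne_zero
  have hnd := (UniqueFactorizationMonoid.squarefree_iff_nodup_normalizedFactors h0).mp hq
  rw [Finset.prod_eq_multiset_prod, Multiset.map_id', Multiset.toFinset_val,
    hnd.dedup, Ideal.prod_normalizedFactors_eq_self h0]

lemma numberField_of_finiteDimensional {F Ω : Type*} [Field F] [NumberField F] [Field Ω]
    [Algebra F Ω] (K : IntermediateField F Ω) [FiniteDimensional F K] : NumberField K := by
  have : CharZero K := charZero_of_injective_algebraMap (algebraMap F K).injective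
  have : IsScalarTower ℚ F K := IsScalarTower.of_algebraMap_eq' (Subsingleton.elim _ _)
  have : FiniteDimensional ℚ K := Module.Finite.trans F K
  exact ⟨⟩

end Families

end CubicCount

/-- **Uniformity estimate for partially ramified `S3`-cubic extensions** (Theorem 3.2).
For every `ε > 0` there is a constant `C` (depending only on `k` and `ε`) such that for
every squarefree integral ideal `q` of `𝒪_k` and every `X ≥ 1`, the number of
`S3`-cubic extensions `K/k` (up to isomorphism) with `Disc(K) ≤ X` that are partially
ramified at every prime dividing `q` is at most `C · X / |q|^(1/6 - ε)`. -/
theorem uniformity_partially_ramified (k : Type*) [Field k] [NumberField k]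
    (ε : ℝ) (hε : 0 < ε) :
    ∃ C : ℝ, 0 < C ∧ ∀ q : Ideal (𝓞 k), Squarefree q → ∀ X : ℝ, 1 ≤ X →
      (countClasses k {K : IntermediateField k (AlgebraicClosure k) |
          IsSThreeCubic k K ∧ (absDisc k K : ℝ) ≤ X ∧
          ∀ p : Ideal (𝓞 k), p.IsPrime → p ∣ q → PartiallyRamified k K p} : ℝ)
        ≤ C * X / (Ideal.absNorm q : ℝ) ^ ((1 : ℝ) / 6 - ε) := by
  obtain ⟨C, hC, h⟩ := CubicCount.card_family_le k
  refine ⟨C, hC, fun q hq X hX => ?_⟩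
  have hq0 : q ≠ ⊥ := hq.ne_zero
  set N : ℝ := (Ideal.absNorm q : ℝ) with hN
  have hN1 : 1 ≤ N := CubicCount.absNorm_pos_of_ne_bot hq0
  have hN0 : 0 < N := by linarith
  set S : Set (IntermediateField k (AlgebraicClosure k)) := {K |
    IsSThreeCubic k K ∧ (absDisc k K : ℝ) ≤ X ∧
      ∀ p : Ideal (𝓞 k), p.IsPrime → p ∣ q → PartiallyRamified k K p} with hS
  set ι := Quotient (Setoid.comap (Subtype.val : S → _) (isoSetoid k)) with hι
  change (Nat.card ι : ℝ) ≤ _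
  rcases finite_or_infinite ι with hfin | hinf
  swap
  · rw [Nat.card_eq_zero_of_infinite, Nat.cast_zero]
    positivity
  have := Fintype.ofFinite ι
  have h3 : ∀ t : ι, Module.finrank k t.out.1 = 3 := fun t => t.out.2.1.1
  have hfd : ∀ t : ι, FiniteDimensional k t.out.1 := fun t =>
    FiniteDimensional.of_finrank_pos (by rw [h3 t]; norm_num)
  have hnf : ∀ t : ι, NumberField t.out.1 := fun t =>
    CubicCount.numberField_of_finiteDimensional t.out.1
  have hcard := h (UniqueFactorizationMonoid.normalizedFactors q).toFinset (fun p hp => ?_)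
    (fun t : ι => t.out.1) Finset.univ X (by linarith) h3 (fun t _ => ?_) (fun t _ p hp => ?_)
    fun t _ t' _ hiso => ?_
  · rw [CubicCount.prod_normalizedFactors_of_squarefree hq, Finset.card_univ,
      ← Nat.card_eq_fintype_card] at hcard
    refine hcard.trans ?_
    rw [← hN, div_eq_mul_inv (C * X), ← Real.rpow_neg hN0.le]
    gcongr
    linarith
  · have hp' := Multiset.mem_toFinset.mp hp
    have hprime := UniqueFactorizationMonoid.prime_of_normalized_factor p hp'
    exact ⟨Ideal.isPrime_of_prime hprime, hprime.ne_zero⟩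
  · have h4 := t.out.2.2.1
    rw [absDisc, dif_pos (hfd t), Nat.cast_natAbs, Int.cast_abs] at h4
    exact h4
  · have hp' := Multiset.mem_toFinset.mp hp
    obtain ⟨P₁, P₂, h₁, -, -, hmap⟩ := t.out.2.2.2 p
      (Ideal.isPrime_of_prime (UniqueFactorizationMonoid.prime_of_normalized_factor p hp'))
      (UniqueFactorizationMonoid.dvd_of_mem_normalizedFactors hp')
    exact ⟨P₁, P₂, h₁, hmap⟩
  · rw [← t.out_eq, ← t'.out_eq]
    exact Quotient.sound hiso
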